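/- arXiv:1510.08779 — 5 statements merged into one kernel-verified Lean document; each statement's English description precedes it below -/
import Mathlib

section
/- For every constant 0 < μ < 1 there is an n₀ such that the following holds for all n ≥ n₀. Let G be a connected δ-hyperbolic graph (δ ≥ 1/2) on n nodes in which every node has degree at most d, for some d > 2, and let p and q be any two nodes of G with Δ = dist_G(p,q) ≥ 1. Then there exist at least t = max{⌊Δ^μ/(56 log d)⌋, 1} subsets of nodes ∅ ⊊ S₁ ⊊ S₂ ⊊ ⋯ ⊊ S_t ⊊ V, each of cardinality at most n/2, such that (i) for every j ∈ {1,…,t}, h_G(S_j) ≤ min{ 8·ln(n/2)/Δ , max{ (1/Δ)^{1−μ} , 500·ln n / (Δ · 2^{Δ^μ/(28·δ·log(2d))}) } }, and (ii) either all of S₁,…,S_t contain the node p, or all of them contain the node q. -/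
open scoped Classical
open Real

namespace PaperHyp

/-- Four-point condition for Gromov δ-hyperbolicity: for every four nodes, when the three
pairwise-sum quantities are ordered as S ≤ M ≤ L, one has L − M ≤ 2δ.  Here the largest is
`max` of the three and the median is the total sum minus the max and the min. -/
def IsHyp {V : Type*} (G : SimpleGraph V) (δ : ℝ) : Prop :=
  ∀ u₁ u₂ u₃ u₄ : V,
    let s₁ : ℝ := G.dist u₁ u₂ + G.dist u₃ u₄
    let s₂ : ℝ := G.dist u₁ u₃ + G.dist u₂ u₄
    let s₃ : ℝ := G.dist u₁ u₄ + G.dist u₂ u₃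
    max s₁ (max s₂ s₃) - (s₁ + s₂ + s₃ - max s₁ (max s₂ s₃) - min s₁ (min s₂ s₃)) ≤ 2 * δ

/-- The node boundary ∂_G(S): nodes outside S adjacent to some node of S. -/
noncomputable def nodeBoundary {V : Type*} (G : SimpleGraph V) [Fintype V] (S : Finset V) :
    Finset V :=
  Finset.univ.filter fun u => u ∉ S ∧ ∃ v ∈ S, G.Adj u v

/-- The node expansion ratio h_G(S) = |∂_G(S)| / |S|. -/
noncomputable def hexp {V : Type*} (G : SimpleGraph V) [Fintype V] (S : Finset V) : ℝ :=
  (nodeBoundary G S).card / S.card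

/-- Twice the Gromov product of `x` and `y` based at `m`. -/
noncomputable def gromovProd {V : Type*} (G : SimpleGraph V) (m x y : V) : ℝ :=
  G.dist x m + G.dist y m - G.dist x y

/-- The closed ball of radius `r` around `p`. -/
noncomputable def distBall {V : Type*} [Fintype V] (G : SimpleGraph V) (p : V) (r : ℕ) :
    Finset V :=
  Finset.univ.filter fun v => G.dist p v ≤ r

section Hyperbolic

variable {V : Type*} {G : SimpleGraph V}

lemma dist_triangle_real (hG : G.Connected) (x y z : V) :
    (G.dist x z : ℝ) ≤ G.dist x y + G.dist y z := by
  exact_mod_cast hG.dist_triangle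

lemma gromovProd_nonneg (hG : G.Connected) (m x y : V) : 0 ≤ gromovProd G m x y := by
  have := dist_triangle_real hG x m y
  rw [G.dist_comm (u := m) (v := y)] at this
  unfold gromovProd
  linarith

lemma IsHyp.min_gromovProd_le {δ : ℝ} (h : IsHyp G δ) (m x y z : V) :
    min (gromovProd G m x y) (gromovProd G m y z) - 2 * δ ≤ gromovProd G m x z := by
  have h4 := h x z m y
  simp only at h4
  unfold gromovProd
  rw [G.dist_comm (u := m) (v := y), G.dist_comm (u := z) (v := y)] at h4
  set a : ℝ := G.dist x z + G.dist y m
  set b : ℝ := G.dist x m + G.dist y z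
  set c : ℝ := G.dist x y + G.dist z m
  have key : a ≤ max b c + 2 * δ := by
    rcases le_total b c with hbc | hbc <;> rcases le_total a b with hab | hab <;>
      rcases le_total a c with hac | hac <;>
      simp only [max_eq_left, max_eq_right, min_eq_left, min_eq_right, *] at h4 ⊢ <;> linarith
  rcases le_total b c with hbc | hbc
  · rw [max_eq_right hbc] at key
    have := min_le_left ((G.dist x m : ℝ) + G.dist y m - G.dist x y)
      ((G.dist y m : ℝ) + G.dist z m - G.dist y z)
    simp only [a, b, c] at *
    linarith
  · rw [max_eq_left hbc] at key
    have := min_le_right ((G.dist x m : ℝ) + G.dist y m - G.dist x y)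
      ((G.dist y m : ℝ) + G.dist z m - G.dist y z)
    simp only [a, b, c] at *
    linarith

lemma dist_le_sub_of_steps (hG : G.Connected) {x : ℕ → V}
    (hx : ∀ i, G.dist (x i) (x (i + 1)) ≤ 1) {a b : ℕ} (hab : a ≤ b) :
    G.dist (x a) (x b) ≤ b - a := by
  induction b, hab using Nat.le_induction with
  | base => simp
  | succ b hb ih =>
    have := hG.dist_triangle (u := x a) (v := x b) (w := x (b + 1))
    have := hx b
    omega

/-- A path avoiding the ball of radius `α` around `m` loses Gromov product only logarithmically
in its length. -/
lemma IsHyp.le_gromovProd_of_steps {δ : ℝ} (h : IsHyp G δ) (hG : G.Connected) {x : ℕ → V}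
    (hx : ∀ i, G.dist (x i) (x (i + 1)) ≤ 1) {α : ℝ} {m : V} (hm : ∀ i, α ≤ G.dist (x i) m)
    (w k a b : ℕ) (hab : a ≤ b) (hk : b ≤ a + w * 2 ^ k) :
    2 * α - w - 2 * k * δ ≤ gromovProd G m (x a) (x b) := by
  induction k generalizing a b with
  | zero =>
    have h1 := dist_le_sub_of_steps hG hx hab
    have h2 : (G.dist (x a) (x b) : ℝ) ≤ w := by
      have : G.dist (x a) (x b) ≤ w := by omega
      exact_mod_cast this
    have := hm a
    have := hm b
    simp only [gromovProd, Nat.cast_zero]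
    linarith
  | succ k ih =>
    set c := min (a + w * 2 ^ k) b
    have hb : b ≤ c + w * 2 ^ k := by rw [pow_succ, ← mul_assoc] at hk; omega
    have h1 := ih a c (by omega) (by omega)
    have h2 := ih c b (by omega) hb
    have h3 := h.min_gromovProd_le m (x a) (x c) (x b)
    have h4 := le_min h1 h2
    push_cast
    linarith

/-- If `u` and `v` lie well on the two sides of a point `m` of a geodesic from `p` to `q`, then
their Gromov product based at `m` is small. -/
lemma IsHyp.gromovProd_le_of_separated {δ : ℝ} (h : IsHyp G δ) (hG : G.Connected) (hδ : 0 ≤ δ)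
    {p q m u v : V} (hm : (G.dist p m : ℝ) + G.dist q m = G.dist p q)
    (hu : (G.dist p u : ℝ) - G.dist q u + 4 * δ < G.dist p m - G.dist q m)
    (hv : (G.dist p m : ℝ) - G.dist q m + 4 * δ < G.dist p v - G.dist q v) :
    gromovProd G m u v ≤ 4 * δ := by
  have h1 := h.min_gromovProd_le m p u q
  have h2 := h.min_gromovProd_le m u v q
  have h3 := gromovProd_nonneg hG m q u
  have h4 := gromovProd_nonneg hG m p v
  by_contra! hc
  have h5 : 4 * δ < gromovProd G m p u := by
    simp only [gromovProd] at *
    linarith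
  have h6 : 4 * δ < gromovProd G m v q := by
    simp only [gromovProd, G.dist_comm (u := v) (v := q)] at *
    linarith
  have h7 : gromovProd G m p q = 0 := by simp only [gromovProd]; linarith
  have h8 := lt_min hc h6
  have h9 : 2 * δ < gromovProd G m u q := by linarith
  have h10 : 2 * δ < min (gromovProd G m p u) (gromovProd G m u q) :=
    lt_min (by linarith) h9
  linarith

/-- A path that starts near `p` and avoids the `α`-neighbourhood of the middle third of a geodesic
from `p` to `q` needs exponentially many steps to cross. -/
lemma IsHyp.potential_lt_of_avoid {δ : ℝ} (h : IsHyp G δ) (hG : G.Connected) (hδ : 1 / 2 ≤ δ)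
    {p q : V} {x : ℕ → V} (hx : ∀ i, G.dist (x i) (x (i + 1)) ≤ 1) {α c : ℝ} {w k : ℕ}
    (hc : -(G.dist p q : ℝ) ≤ 3 * c) (h0 : (G.dist p (x 0) : ℝ) - G.dist q (x 0) < c)
    (hm : ∀ i : ℕ, G.dist p q ≤ 3 * i → 3 * i ≤ 2 * G.dist p q → ∃ m, G.dist p m = i ∧
      G.dist q m + i = G.dist p q ∧ ∀ j, α ≤ G.dist (x j) m)
    (hα : w + (2 * k + 4) * δ < 2 * α) (i : ℕ) (hi : c + i * (20 * δ) ≤ 0) (j : ℕ)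
    (hj : j ≤ i * (w * 2 ^ k)) :
    (G.dist p (x j) : ℝ) - G.dist q (x j) < c + i * (20 * δ) := by
  induction i generalizing j with
  | zero =>
    obtain rfl : j = 0 := by simpa using hj
    simpa using h0
  | succ i ih =>
    push_cast at hi ⊢
    have ih := ih (by linarith)
    set D : ℝ := (G.dist p q : ℝ) with hD
    set c' : ℝ := c + i * (20 * δ) with hc'
    have hcc : c ≤ c' := by
      have : 0 ≤ (i : ℝ) * (20 * δ) := by positivity
      linarith
    by_contra! hcon
    have hex : ∃ T, c' ≤ (G.dist p (x T) : ℝ) - G.dist q (x T) := ⟨j, by linarith⟩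
    set T := Nat.find hex with hT
    have hT1 : c' ≤ (G.dist p (x T) : ℝ) - G.dist q (x T) := Nat.find_spec hex
    have hTj : T ≤ j := Nat.find_min' hex (by linarith)
    have hTi : i * (w * 2 ^ k) < T := by
      by_contra! hle
      linarith [ih T hle]
    have hT2 : (G.dist p (x T) : ℝ) - G.dist q (x T) < c' + 2 := by
      have hpred : ¬ c' ≤ (G.dist p (x (T - 1)) : ℝ) - G.dist q (x (T - 1)) :=
        Nat.find_min hex (by omega)
      have hs := hx (T - 1)
      rw [Nat.sub_add_cancel (by omega)] at hs
      have hs' : (G.dist (x (T - 1)) (x T) : ℝ) ≤ 1 := by exact_mod_cast hs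
      have t1 := dist_triangle_real hG p (x (T - 1)) (x T)
      have t2 := dist_triangle_real hG q (x T) (x (T - 1))
      rw [G.dist_comm (u := x T)] at t2
      push Not at hpred
      linarith
    set l := ⌊(c' + 2 + 4 * δ + D) / 2⌋₊ + 1 with hl
    have hl1 : (c' + 2 + 4 * δ + D) / 2 < l := by
      rw [hl]; push_cast; exact Nat.lt_floor_add_one _
    have hl2 : (l : ℝ) ≤ (c' + 2 + 4 * δ + D) / 2 + 1 := by
      rw [hl]; push_cast
      have : (0 : ℝ) ≤ D := by positivity
      linarith [Nat.floor_le (show 0 ≤ (c' + 2 + 4 * δ + D) / 2 by linarith)]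
    have hm1 : (G.dist p q : ℝ) ≤ 3 * l := by linarith
    have hm2 : (3 * l : ℝ) ≤ 2 * G.dist p q := by linarith
    obtain ⟨m, hpm, hqm, hav⟩ := hm l (by exact_mod_cast hm1) (by exact_mod_cast hm2)
    have hpm' : (G.dist p m : ℝ) = l := by exact_mod_cast hpm
    have hqm' : (G.dist q m : ℝ) + l = D := by rw [hD]; exact_mod_cast hqm
    have hup := h.gromovProd_le_of_separated hG (by linarith) (u := x T) (v := x j) (m := m)
      (p := p) (q := q) (by linarith) (by linarith) (by linarith)
    have hlow := h.le_gromovProd_of_steps hG hx hav w k T j hTj (by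
      have : (i + 1) * (w * 2 ^ k) = i * (w * 2 ^ k) + w * 2 ^ k := by ring
      omega)
    linarith

lemma exists_dist_eq (hG : G.Connected) {p q : V} {i : ℕ} (hi : i ≤ G.dist p q) :
    ∃ m, G.dist p m = i ∧ G.dist q m + i = G.dist p q := by
  obtain ⟨w, hw⟩ := hG.exists_walk_length_eq_dist p q
  refine ⟨w.getVert i, ?_⟩
  have h1 := SimpleGraph.dist_le (w.take i)
  have h2 := SimpleGraph.dist_le (w.drop i)
  have h3 := hG.dist_triangle (u := p) (v := w.getVert i) (w := q)
  rw [SimpleGraph.Walk.take_length] at h1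
  rw [SimpleGraph.Walk.drop_length] at h2
  rw [G.dist_comm (u := q)]
  omega

end Hyperbolic

/-- `t` strictly nested node sets containing `p`, each with at most half of the nodes and of
expansion at most `T`. -/
def HasWitnesses {V : Type*} [Fintype V] (G : SimpleGraph V) (p : V) (T : ℝ) (t : ℕ) : Prop :=
  ∃ S : Fin t → Finset V, (∀ i j, i < j → S i ⊂ S j) ∧
    (∀ i, 2 * (S i).card ≤ Fintype.card V) ∧ (∀ i, hexp G (S i) ≤ T) ∧ ∀ i, p ∈ S i

section Growth

variable {V : Type*} [Fintype V] {G : SimpleGraph V}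

lemma HasWitnesses.mono {p : V} {T T' : ℝ} {t : ℕ} (h : HasWitnesses G p T t) (hT : T ≤ T') :
    HasWitnesses G p T' t := by
  obtain ⟨S, h1, h2, h3, h4⟩ := h
  exact ⟨S, h1, h2, fun i => (h3 i).trans hT, h4⟩

@[simp]
lemma mem_distBall {p v : V} {r : ℕ} : v ∈ distBall G p r ↔ G.dist p v ≤ r := by
  simp [distBall]

lemma mem_nodeBoundary {S : Finset V} {u : V} :
    u ∈ nodeBoundary G S ↔ u ∉ S ∧ ∃ v ∈ S, G.Adj u v := by
  simp [nodeBoundary]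

lemma nodeBoundary_distBall_subset (hG : G.Connected) (p : V) (r : ℕ) :
    nodeBoundary G (distBall G p r) ⊆ distBall G p (r + 1) \ distBall G p r := by
  intro u hu
  obtain ⟨h1, v, hv, huv⟩ := mem_nodeBoundary.1 hu
  refine Finset.mem_sdiff.2 ⟨mem_distBall.2 ?_, h1⟩
  have h2 := hG.dist_triangle (u := p) (v := v) (w := u)
  have h3 := SimpleGraph.dist_eq_one_iff_adj.2 huv.symm
  have h4 := mem_distBall.1 hv
  omega

lemma distBall_mono (p : V) {r s : ℕ} (h : r ≤ s) : distBall G p r ⊆ distBall G p s :=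
  fun _ hv => mem_distBall.2 ((mem_distBall.1 hv).trans h)

lemma distBall_ssubset (hG : G.Connected) {p q : V} {r s : ℕ} (h : r < s)
    (hs : s ≤ G.dist p q) : distBall G p r ⊂ distBall G p s := by
  obtain ⟨m, hm, -⟩ := exists_dist_eq hG hs
  refine (Finset.ssubset_iff_of_subset (distBall_mono p h.le)).2 ⟨m, ?_, ?_⟩ <;>
    simp only [mem_distBall] <;> omega

lemma card_distBall_le [DecidableRel G.Adj] (hG : G.Connected) {d : ℕ}
    (hd : ∀ v, G.degree v ≤ d) (p : V) (r : ℕ) : (distBall G p r).card ≤ (d + 1) ^ r := by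
  induction r with
  | zero =>
    have : distBall G p 0 ⊆ {p} := by
      intro v hv
      have := mem_distBall.1 hv
      rw [Nat.le_zero, hG.dist_eq_zero_iff] at this
      simp [this]
    simpa using Finset.card_le_card this
  | succ r ih =>
    have hsub : distBall G p (r + 1) ⊆
        (distBall G p r).biUnion fun v => insert v (G.neighborFinset v) := by
      intro u hu
      rw [Finset.mem_biUnion]
      rcases Nat.lt_or_ge r (G.dist p u) with h | h
      · obtain ⟨m, hm, hm'⟩ := exists_dist_eq hG h.le
        have hu := mem_distBall.1 hu
        refine ⟨m, mem_distBall.2 hm.le, Finset.mem_insert_of_mem ?_⟩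
        rw [SimpleGraph.mem_neighborFinset, ← SimpleGraph.dist_eq_one_iff_adj, G.dist_comm]
        omega
      · exact ⟨u, mem_distBall.2 h, Finset.mem_insert_self _ _⟩
    calc (distBall G p (r + 1)).card ≤ _ := Finset.card_le_card hsub
      _ ≤ (distBall G p r).card * (d + 1) := by
        refine Finset.card_biUnion_le_card_mul _ _ _ fun v _ => ?_
        refine (Finset.card_insert_le _ _).trans ?_
        rw [SimpleGraph.card_neighborFinset_eq_degree]
        exact Nat.succ_le_succ (hd v)
      _ ≤ (d + 1) ^ r * (d + 1) := Nat.mul_le_mul_right _ ih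
      _ = (d + 1) ^ (r + 1) := (pow_succ _ _).symm

/-- A monotone sequence grows by a factor `1 + x` at every step outside the set of slow steps. -/
lemma pow_le_of_slow_steps {f : ℕ → ℝ} {x : ℝ} (hx : 0 ≤ x) (hf : Monotone f) (h0 : 1 ≤ f 0)
    (R : ℕ) :
    (1 + x) ^ (R - ((Finset.range R).filter fun j => f (j + 1) ≤ (1 + x) * f j).card) ≤ f R := by
  induction R with
  | zero => simpa using h0
  | succ R ih =>
    have hle := Finset.card_filter_le (Finset.range R) fun j => f (j + 1) ≤ (1 + x) * f j
    rw [Finset.card_range] at hle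
    rw [Finset.range_add_one, Finset.filter_insert]
    split_ifs with h
    · rw [Finset.card_insert_of_notMem (by simp), Nat.add_sub_add_right]
      exact ih.trans (hf R.le_succ)
    · rw [Nat.succ_sub hle, pow_succ']
      push Not at h
      exact (mul_le_mul_of_nonneg_left ih (by linarith)).trans h.le

lemma hexp_le {S : Finset V} {x : ℝ} (hS : S.Nonempty)
    (h : ((nodeBoundary G S).card : ℝ) ≤ x * S.card) : hexp G S ≤ x := by
  have : (0 : ℝ) < S.card := by exact_mod_cast hS.card_pos
  rw [hexp, div_le_iff₀ this]
  exact h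

/-- Either `t` of the balls of radius less than `R` have expansion at most `x`, or the balls grow
exponentially. -/
lemma hasWitnesses_or_pow_le_card_distBall (hG : G.Connected) {p q : V} {R : ℕ}
    (hR : R ≤ G.dist p q) (hn : 2 * (distBall G p R).card ≤ Fintype.card V) {x : ℝ} (hx : 0 ≤ x)
    (t : ℕ) : HasWitnesses G p x t ∨ (1 + x) ^ (R - t) ≤ ((distBall G p R).card : ℝ) := by
  set f : ℕ → ℝ := fun j => ((distBall G p j).card : ℝ) with hf
  have hmono : Monotone f := fun i j hij => by
    simpa [hf] using Finset.card_le_card (distBall_mono p hij)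
  have h0 : 1 ≤ f 0 := by
    have : 0 < (distBall G p 0).card := Finset.card_pos.2 ⟨p, by simp⟩
    exact Nat.one_le_cast.2 this
  set A := (Finset.range R).filter fun j => f (j + 1) ≤ (1 + x) * f j with hA
  rcases le_or_gt t A.card with h | h
  · left
    obtain ⟨e, he, hmem⟩ : ∃ e : Fin t → ℕ, StrictMono e ∧ ∀ i, e i ∈ A :=
      ⟨fun i => A.orderEmbOfFin rfl (Fin.castLE h i),
        (A.orderEmbOfFin rfl).strictMono.comp (Fin.strictMono_castLE h),
        fun i => A.orderEmbOfFin_mem rfl _⟩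
    simp only [hA, Finset.mem_filter, Finset.mem_range] at hmem
    refine ⟨fun i => distBall G p (e i), fun i j hij => ?_, fun i => ?_, fun i => ?_, by simp⟩
    · exact distBall_ssubset hG (he hij) ((hmem j).1.le.trans hR)
    · have := Finset.card_le_card (distBall_mono (G := G) p (hmem i).1.le)
      dsimp only
      omega
    · refine hexp_le ⟨p, by simp⟩ ?_
      have h1 := Finset.card_le_card (nodeBoundary_distBall_subset hG p (e i))
      have h2 := Finset.card_sdiff_add_card_eq_card (distBall_mono (G := G) p (e i).le_succ)
      have h3 : ((nodeBoundary G (distBall G p (e i))).card : ℝ) + f (e i) ≤ f (e i + 1) := by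
        simp only [hf]
        exact_mod_cast (Nat.add_le_add_right h1 _).trans h2.le
      have h4 := (hmem i).2
      simp only [hf] at h3 h4
      linarith
  · right
    exact (pow_le_pow_right₀ (by linarith) (Nat.sub_le_sub_left h.le R)).trans
      (pow_le_of_slow_steps hx hmono h0 R)

/-- Removing nodes one at a time from a set with small boundary gives nested witnesses. -/
lemma hasWitnesses_of_card_nodeBoundary_le {p : V} {F : Finset V} (hp : p ∈ F)
    (hF : 2 * F.card ≤ Fintype.card V) {t : ℕ} (ht : t < F.card) {x : ℝ}
    (hx : ((nodeBoundary G F).card : ℝ) + t ≤ x * (F.card - t)) : HasWitnesses G p x t := by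
  have hcard : Fintype.card (Fin t) ≤ Fintype.card (F.erase p) := by
    rw [Fintype.card_fin, Fintype.card_coe, Finset.card_erase_of_mem hp]
    omega
  obtain ⟨e⟩ := Function.Embedding.nonempty_of_card_le hcard
  set X : Fin t → Finset V := fun i =>
    (Finset.univ.filter fun k => i < k).image fun k => (e k : V) with hX
  have hXcard : ∀ i, (X i).card ≤ t := fun i =>
    Finset.card_image_le.trans ((Finset.card_filter_le _ _).trans (by simp))
  have hpX : ∀ i, p ∈ F \ X i := by
    intro i
    refine Finset.mem_sdiff.2 ⟨hp, fun hmem => ?_⟩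
    obtain ⟨k, -, hk⟩ := Finset.mem_image.1 hmem
    exact Finset.ne_of_mem_erase (e k).2 hk
  refine ⟨fun i => F \ X i, ?_, ?_, ?_, hpX⟩
  · intro i j hij
    refine (Finset.ssubset_iff_of_subset (Finset.sdiff_subset_sdiff le_rfl ?_)).2
      ⟨e j, ?_, ?_⟩
    · refine Finset.image_subset_image fun k hk => ?_
      simp only [Finset.mem_filter, Finset.mem_univ, true_and] at hk ⊢
      exact hij.trans hk
    · refine Finset.mem_sdiff.2 ⟨Finset.mem_of_mem_erase (e j).2, fun hmem => ?_⟩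
      obtain ⟨k, hk, hkj⟩ := Finset.mem_image.1 hmem
      have : k = j := e.injective (Subtype.ext hkj)
      simp [this] at hk
    · intro hmem
      exact (Finset.mem_sdiff.1 hmem).2 (Finset.mem_image.2 ⟨j, by simpa using hij, rfl⟩)
  · intro i
    have := Finset.card_le_card (Finset.sdiff_subset (s := F) (t := X i))
    change 2 * (F \ X i).card ≤ _
    omega
  · intro i
    have h1 : nodeBoundary G (F \ X i) ⊆ nodeBoundary G F ∪ X i := by
      intro u hu
      obtain ⟨h1, v, hv, huv⟩ := mem_nodeBoundary.1 hu
      rw [Finset.mem_union, mem_nodeBoundary]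
      by_cases huF : u ∈ F
      · right
        by_contra hc
        exact h1 (Finset.mem_sdiff.2 ⟨huF, hc⟩)
      · exact Or.inl ⟨huF, v, (Finset.mem_sdiff.1 hv).1, huv⟩
    have h2 : ((nodeBoundary G (F \ X i)).card : ℝ) ≤ (nodeBoundary G F).card + t := by
      exact_mod_cast (Finset.card_le_card h1).trans
        ((Finset.card_union_le _ _).trans (Nat.add_le_add_left (hXcard i) _))
    have h3 : (F.card : ℝ) - t ≤ (F \ X i).card := by
      have := Finset.le_card_sdiff (X i) F
      have := hXcard i
      rw [sub_le_iff_le_add]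
      norm_cast
      omega
    have ht' : (0 : ℝ) < F.card - t := by
      rw [sub_pos]; exact_mod_cast ht
    have hx0 : 0 ≤ x := by
      by_contra! hneg
      have h4 : x * ((F.card : ℝ) - t) < 0 := mul_neg_of_neg_of_pos hneg ht'
      have h5 : (0 : ℝ) ≤ (nodeBoundary G F).card + t := by positivity
      linarith
    exact hexp_le ⟨p, hpX i⟩ (h2.trans (hx.trans (mul_le_mul_of_nonneg_left h3 hx0)))

end Growth

/-- The nodes reached from `A` by paths with at most `j` steps that avoid `C`. -/
noncomputable def reachSet {V : Type*} [Fintype V] (G : SimpleGraph V) (C A : Finset V) (j : ℕ) :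
    Finset V :=
  Finset.univ.filter fun v => ∃ x : ℕ → V, x 0 ∈ A ∧ x j = v ∧
    (∀ i, G.dist (x i) (x (i + 1)) ≤ 1) ∧ ∀ i, x i ∉ C

section Reach

variable {V : Type*} [Fintype V] {G : SimpleGraph V} {C A : Finset V}

lemma mem_reachSet {j : ℕ} {v : V} : v ∈ reachSet G C A j ↔ ∃ x : ℕ → V, x 0 ∈ A ∧ x j = v ∧
    (∀ i, G.dist (x i) (x (i + 1)) ≤ 1) ∧ ∀ i, x i ∉ C := by
  simp [reachSet]

lemma subset_reachSet_zero (h : Disjoint A C) : A ⊆ reachSet G C A 0 := fun v hv =>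
  mem_reachSet.2 ⟨fun _ => v, hv, rfl, by simp, fun _ => Finset.disjoint_left.1 h hv⟩

lemma mem_reachSet_succ {j : ℕ} {v u : V} (hv : v ∈ reachSet G C A j) (huv : G.dist v u ≤ 1)
    (hu : u ∉ C) : u ∈ reachSet G C A (j + 1) := by
  obtain ⟨x, h0, hj, hx, hC⟩ := mem_reachSet.1 hv
  refine mem_reachSet.2 ⟨fun i => if i ≤ j then x i else u, by simpa using h0, by simp, ?_, ?_⟩
  · intro i
    rcases lt_trichotomy i j with h | rfl | h
    · simpa [h.le, Nat.succ_le_of_lt h] using hx i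
    · simpa [hj] using huv
    · simp [show ¬ i ≤ j by omega, show ¬ i + 1 ≤ j by omega]
  · intro i
    dsimp only
    split_ifs
    exacts [hC i, hu]

lemma reachSet_mono : Monotone (reachSet G C A) := by
  refine monotone_nat_of_le_succ fun j v hv => ?_
  obtain ⟨x, -, rfl, -, hC⟩ := mem_reachSet.1 hv
  exact mem_reachSet_succ hv (by simp) (hC j)

lemma nodeBoundary_reachSet_subset (j : ℕ) :
    nodeBoundary G (reachSet G C A j) ⊆ reachSet G C A (j + 1) \ reachSet G C A j ∪ C := by
  intro u hu
  obtain ⟨h1, v, hv, huv⟩ := mem_nodeBoundary.1 hu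
  rw [Finset.mem_union, Finset.mem_sdiff]
  by_cases hC : u ∈ C
  · exact Or.inr hC
  · exact Or.inl
      ⟨mem_reachSet_succ hv (SimpleGraph.dist_eq_one_iff_adj.2 huv.symm).le hC, h1⟩

/-- Growing a large set `A` for long enough while avoiding a small set `C` produces witnesses. -/
lemma hasWitnesses_of_reachSet (hAC : Disjoint A C) {p : V} (hp : p ∈ A) {J : ℕ}
    (hJ : 2 * (reachSet G C A J).card ≤ Fintype.card V) {x y : ℝ} (hx : 0 ≤ x) (hy : 0 ≤ y)
    (hpow : (Fintype.card V : ℝ) / 2 < (1 + x) ^ J) {t : ℕ} (ht : 2 * t ≤ A.card)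
    (hC : (C.card : ℝ) + t ≤ y * A.card) : HasWitnesses G p (2 * x + 2 * y) t := by
  set f : ℕ → ℝ := fun j => ((reachSet G C A j).card : ℝ) with hf
  have hsub : ∀ j, A ⊆ reachSet G C A j := fun j =>
    (subset_reachSet_zero hAC).trans (reachSet_mono j.zero_le)
  have hmono : Monotone f := fun i j hij => by
    simpa [hf] using Finset.card_le_card (reachSet_mono hij)
  have hApos : 0 < A.card := Finset.card_pos.2 ⟨p, hp⟩
  have h0 : 1 ≤ f 0 := Nat.one_le_cast.2 (hApos.trans_le (Finset.card_le_card (hsub 0)))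
  have hslow := pow_le_of_slow_steps hx hmono h0 J
  obtain ⟨j, hj⟩ : ((Finset.range J).filter fun j => f (j + 1) ≤ (1 + x) * f j).Nonempty := by
    rw [Finset.nonempty_iff_ne_empty]
    intro hemp
    rw [hemp, Finset.card_empty, Nat.sub_zero] at hslow
    have : 2 * f J ≤ Fintype.card V := by
      simp only [hf]
      exact_mod_cast hJ
    linarith
  rw [Finset.mem_filter, Finset.mem_range] at hj
  have hAj := Finset.card_le_card (hsub j)
  have hAj' : (A.card : ℝ) ≤ f j := Nat.cast_le.2 hAj
  refine hasWitnesses_of_card_nodeBoundary_le (hsub j hp) ?_ (t := t) (by omega) ?_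
  · have := Finset.card_le_card (reachSet_mono (G := G) (C := C) (A := A) hj.1.le)
    omega
  · have h1 := (Finset.card_le_card (nodeBoundary_reachSet_subset (G := G) (C := C) (A := A) j)).trans
      (Finset.card_union_le _ _)
    have h2 := Finset.card_sdiff_add_card_eq_card
      (reachSet_mono (G := G) (C := C) (A := A) j.le_succ)
    have h3 : ((nodeBoundary G (reachSet G C A j)).card : ℝ) + f j ≤ f (j + 1) + C.card := by
      simp only [hf]
      norm_cast
      simp only [Nat.succ_eq_add_one] at h2
      omega
    have h4 : (2 * t : ℝ) ≤ A.card := by exact_mod_cast ht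
    have h5 := hj.2
    have h6 := mul_le_mul_of_nonneg_left hAj' hy
    have h7 : (x + y) * f j ≤ (2 * x + 2 * y) * (f j - t) := by
      have : 0 ≤ (x + y) * (f j - 2 * t) := mul_nonneg (by linarith) (by linarith)
      linarith
    change _ ≤ (2 * x + 2 * y) * (f j - t)
    linarith

/-- Paths of length `D * 2 ^ E` from the ball of radius `D / 4` around `p` that avoid the
`4 * δ * E`-neighbourhood of the middle third of a geodesic do not get past the middle. -/
lemma IsHyp.dist_lt_of_mem_reachSet {δ : ℝ} (h : IsHyp G δ) (hG : G.Connected) (hδ : 1 / 2 ≤ δ)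
    {p q : V} {E : ℝ} (hE : 5 ≤ E) (hD : 280 * δ ≤ G.dist p q)
    (hm : ∀ i : ℕ, G.dist p q ≤ 3 * i → 3 * i ≤ 2 * G.dist p q → ∃ m, G.dist p m = i ∧
      G.dist q m + i = G.dist p q ∧ ∀ v, v ∉ C → 4 * δ * E ≤ G.dist v m)
    {v : V} (hv : v ∈ reachSet G C (distBall G p (G.dist p q / 4))
      ⌊(G.dist p q : ℝ) * 2 ^ E⌋₊) : G.dist p v < G.dist q v := by
  obtain ⟨x, h0, rfl, hx, hC⟩ := mem_reachSet.1 hv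
  set D : ℝ := (G.dist p q : ℝ) with hDdef
  set J := ⌊D * (2 : ℝ) ^ E⌋₊ with hJ
  set K := ⌊D / (60 * δ)⌋₊ with hK
  set w := ⌈δ⌉₊
  set k := ⌈E⌉₊ + 7 with hk
  have hδ0 : 0 < δ := by linarith
  have hK1 : (K : ℝ) * (60 * δ) ≤ D := by
    rw [← le_div_iff₀ (by positivity)]
    exact Nat.floor_le (by positivity)
  have hK2 : D ≤ K * (80 * δ) := by
    have h1 : D / (60 * δ) < K + 1 := Nat.lt_floor_add_one _
    rw [div_lt_iff₀ (by positivity)] at h1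
    linarith
  have hw1 : δ ≤ w := Nat.le_ceil _
  have hw2 : (w : ℝ) < δ + 1 := Nat.ceil_lt_add_one hδ0.le
  have hk1 : (k : ℝ) < E + 8 := by
    have := Nat.ceil_lt_add_one (show 0 ≤ E by linarith)
    rw [hk]; push_cast; linarith
  have hk2 : 128 * (2 : ℝ) ^ E ≤ 2 ^ k := by
    have h1 : (2 : ℝ) ^ E ≤ (2 : ℝ) ^ (⌈E⌉₊ : ℝ) :=
      Real.rpow_le_rpow_of_exponent_le (by norm_num) (Nat.le_ceil _)
    rw [Real.rpow_natCast] at h1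
    rw [hk, pow_add]
    linarith
  have hx0 : (G.dist p (x 0) : ℝ) ≤ D / 4 := by
    have h1 := mem_distBall.1 h0
    have h2 : G.dist p (x 0) * 4 ≤ G.dist p q := by omega
    have h3 : (G.dist p (x 0) : ℝ) * 4 ≤ D := by rw [hDdef]; exact_mod_cast h2
    linarith
  have hqx0 : D ≤ G.dist p (x 0) + G.dist q (x 0) := by
    rw [G.dist_comm (u := q)]
    exact dist_triangle_real hG _ _ _
  have hJle : J ≤ K * (w * 2 ^ k) := by
    have h1 : (J : ℝ) ≤ D * 2 ^ E := Nat.floor_le (by positivity)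
    have h2 : D * 2 ^ E ≤ K * (80 * δ) * 2 ^ E := by gcongr
    have h3 : (K : ℝ) * (δ * (128 * 2 ^ E)) ≤ K * (w * 2 ^ k) := by gcongr
    have h4 : (0 : ℝ) ≤ K * δ * 2 ^ E := by positivity
    have h5 : (J : ℝ) ≤ K * (w * 2 ^ k) := by linarith
    exact_mod_cast h5
  have hα : (w : ℝ) + (2 * k + 4) * δ < 2 * (4 * δ * E) := by
    have h1 : (k : ℝ) * δ ≤ (E + 8) * δ := by gcongr
    have h2 : 5 * δ ≤ E * δ := by gcongr
    linarith
  have := h.potential_lt_of_avoid hG hδ (p := p) (q := q) hx (c := -D / 3) (w := w)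
    (k := k) (by linarith) (by linarith) (fun i hi1 hi2 => by
      obtain ⟨m, h1, h2, h3⟩ := hm i hi1 hi2
      exact ⟨m, h1, h2, fun j => h3 _ (hC j)⟩) hα K (by linarith) J hJle
  have h3 : (G.dist p (x J) : ℝ) < G.dist q (x J) := by linarith
  exact_mod_cast h3

end Reach

lemma two_rpow_le_one_add_pow {x : ℝ} (h0 : 0 ≤ x) (h1 : x ≤ 1) (m : ℕ) :
    (2 : ℝ) ^ (x * m) ≤ (1 + x) ^ m := by
  have h := rpow_one_add_le_one_add_mul_self (s := 1) (by norm_num) h0 h1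
  rw [mul_one, one_add_one_eq_two] at h
  rw [Real.rpow_mul_natCast (by norm_num)]
  exact pow_le_pow_left₀ (by positivity) h m

section Cases

variable {V : Type*} [Fintype V] {G : SimpleGraph V}

lemma hasWitnesses_of_two_le (p : V) {T : ℝ} (hT : 2 ≤ T) (hn : 100 ≤ Fintype.card V) {t : ℕ}
    (ht : 56 * t ≤ Fintype.card V + 56) : HasWitnesses G p T t := by
  obtain ⟨F, hpF, -, hF⟩ := Finset.exists_subsuperset_card_eq (s := {p})
    (t := (Finset.univ : Finset V)) (n := Fintype.card V / 2) (Finset.subset_univ _)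
    (by rw [Finset.card_singleton]; omega) (by rw [Finset.card_univ]; omega)
  refine HasWitnesses.mono ?_ hT
  refine hasWitnesses_of_card_nodeBoundary_le (hpF (Finset.mem_singleton_self p))
    (by omega) (by omega) ?_
  have h1 : (nodeBoundary G F).card ≤ Fᶜ.card :=
    Finset.card_le_card fun u hu => Finset.mem_compl.2 (mem_nodeBoundary.1 hu).1
  rw [Finset.card_compl] at h1
  have h2 : (nodeBoundary G F).card + t + 2 * t ≤ 2 * F.card := by omega
  have h3 : ((nodeBoundary G F).card : ℝ) + t + 2 * t ≤ 2 * F.card := by exact_mod_cast h2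
  linarith

lemma two_mul_card_le_or_of_disjoint {S T : Finset V} (h : Disjoint S T) :
    2 * S.card ≤ Fintype.card V ∨ 2 * T.card ≤ Fintype.card V := by
  have := Finset.card_union_of_disjoint h
  have := Finset.card_le_univ (S ∪ T)
  omega

lemma hasWitnesses_ball (hG : G.Connected) {p q : V} {R t : ℕ} (hR : 2 * R ≤ G.dist p q)
    (hn : 2 * (distBall G p R).card ≤ Fintype.card V)
    (hRt : (2 / 5 : ℝ) * G.dist p q ≤ (R : ℝ) - t)
    (hD : 1 ≤ G.dist p q) (hX : 0 < Real.log ((Fintype.card V : ℝ) / 2))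
    (hT : 8 * Real.log ((Fintype.card V : ℝ) / 2) / (G.dist p q : ℝ) ≤ 2) :
    HasWitnesses G p (8 * Real.log ((Fintype.card V : ℝ) / 2) / (G.dist p q : ℝ)) t := by
  have hD' : (1 : ℝ) ≤ G.dist p q := by exact_mod_cast hD
  set D : ℝ := (G.dist p q : ℝ)
  set X := Real.log ((Fintype.card V : ℝ) / 2)
  have hx : 0 ≤ 4 * X / D := by positivity
  have h8 : 8 * X / D = 2 * (4 * X / D) := by ring
  rcases hasWitnesses_or_pow_le_card_distBall hG (q := q) (by omega) hn hx t with h | h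
  · exact h.mono (by linarith)
  · exfalso
    have h1 := two_rpow_le_one_add_pow hx (by linarith) (R - t)
    have htR : t ≤ R := by
      have : (t : ℝ) ≤ R := by linarith
      exact_mod_cast this
    have h2 : (2 : ℝ) * (distBall G p R).card ≤ Fintype.card V := by exact_mod_cast hn
    have h3 : (2 : ℝ) ^ (4 * X / D * (R - t : ℕ)) ≤ (Fintype.card V : ℝ) / 2 := by linarith
    have h4 := Real.log_le_log (by positivity) h3
    rw [Real.log_rpow (by norm_num), Nat.cast_sub htR] at h4
    have h5 : 4 * X / D * (2 / 5 * D) * 0.69 ≤ 4 * X / D * (R - t) * Real.log 2 := by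
      have := Real.log_two_gt_d9
      have h7 : (0 : ℝ) ≤ R - t := by linarith
      gcongr
      linarith
    have h6 : 4 * X / D * (2 / 5 * D) = 8 / 5 * X := by field_simp; norm_num
    rw [h6] at h5
    change _ ≤ X at h4
    linarith

lemma hasWitnesses_of_log_bound (hG : G.Connected) {p q : V} (hD : 100 ≤ G.dist p q) {t : ℕ}
    (ht : 56 * (t : ℝ) ≤ G.dist p q + 56) (hX : 0 < Real.log ((Fintype.card V : ℝ) / 2))
    (hT : 8 * Real.log ((Fintype.card V : ℝ) / 2) / (G.dist p q : ℝ) ≤ 2) :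
    HasWitnesses G p (8 * Real.log ((Fintype.card V : ℝ) / 2) / (G.dist p q : ℝ)) t ∨
    HasWitnesses G q (8 * Real.log ((Fintype.card V : ℝ) / 2) / (G.dist p q : ℝ)) t := by
  set R := (G.dist p q - 1) / 2 with hR
  have hdisj : Disjoint (distBall G p R) (distBall G q R) := by
    rw [Finset.disjoint_left]
    intro v hp hq
    rw [mem_distBall] at hp hq
    have := hG.dist_triangle (u := p) (v := v) (w := q)
    rw [G.dist_comm (u := v)] at this
    omega
  have hD' : (100 : ℝ) ≤ G.dist p q := by exact_mod_cast hD
  have hRt : (2 / 5 : ℝ) * G.dist p q ≤ (R : ℝ) - t := by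
    have h1 : G.dist p q ≤ 2 * R + 2 := by omega
    have h2 : (G.dist p q : ℝ) ≤ 2 * R + 2 := by exact_mod_cast h1
    linarith
  rcases two_mul_card_le_or_of_disjoint hdisj with h | h
  · exact Or.inl (hasWitnesses_ball hG (by omega) h hRt (by omega) hX hT)
  · rw [G.dist_comm (u := p)] at *
    exact Or.inr (hasWitnesses_ball hG (by omega) h hRt (by omega) hX hT)

/-- The one-sided construction for the exponential bound, given a small separating set `C`. -/
lemma hasWitnesses_of_separator (hG : G.Connected) {p q : V} {A E : ℝ} (hA : 1 ≤ A)
    (hAD : A ≤ G.dist p q) (hE : 5 ≤ E) (hD : 100 ≤ G.dist p q)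
    (hbig : 16 * (G.dist p q : ℝ) ^ 2 ≤ (2 : ℝ) ^ (2 * A / 35)) (hn : 2 ≤ Fintype.card V)
    (hT : 500 * Real.log (Fintype.card V) / ((G.dist p q : ℝ) * (2 : ℝ) ^ E) ≤ 2) {t : ℕ}
    (ht : 56 * (t : ℝ) ≤ A + 56) {C : Finset V}
    (hC : (C.card : ℝ) ≤ ((G.dist p q : ℝ) + 1) * (2 : ℝ) ^ (A / 7))
    (hdisj : Disjoint (distBall G p (G.dist p q / 4)) C)
    (hJ : 2 * (reachSet G C (distBall G p (G.dist p q / 4))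
      ⌊(G.dist p q : ℝ) * 2 ^ E⌋₊).card ≤ Fintype.card V) :
    HasWitnesses G p (max (A / G.dist p q)
      (500 * Real.log (Fintype.card V) / ((G.dist p q : ℝ) * (2 : ℝ) ^ E))) t := by
  have hD' : (100 : ℝ) ≤ G.dist p q := by exact_mod_cast hD
  set D : ℝ := (G.dist p q : ℝ) with hDdef
  set R := G.dist p q / 4 with hR
  set B := distBall G p R with hB
  set J := ⌊D * (2 : ℝ) ^ E⌋₊ with hJdef
  have hn' : (2 : ℝ) ≤ Fintype.card V := by exact_mod_cast hn
  set n : ℝ := (Fintype.card V : ℝ) with hndef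
  have hlog : 0 < Real.log n := Real.log_pos (by linarith)
  have hBn : 2 * B.card ≤ Fintype.card V := by
    have := Finset.card_le_card
      ((subset_reachSet_zero (G := G) hdisj).trans (reachSet_mono J.zero_le))
    omega
  rcases hasWitnesses_or_pow_le_card_distBall hG (q := q) (by omega) hBn
    (show 0 ≤ A / D by positivity) t with h | h
  · exact h.mono (le_max_left _ _)
  have hRD : D ≤ 4 * R + 3 := by
    have : G.dist p q ≤ 4 * R + 3 := by omega
    rw [hDdef]; exact_mod_cast this
  have htR : t ≤ R := by
    have : (t : ℝ) ≤ R := by linarith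
    exact_mod_cast this
  have hBcard : (2 : ℝ) ^ (A / 5) ≤ B.card := by
    refine le_trans ?_ ((two_rpow_le_one_add_pow (by positivity)
      (div_le_one_of_le₀ hAD (by positivity)) (R - t)).trans h)
    refine Real.rpow_le_rpow_of_exponent_le (by norm_num) ?_
    have h1 : D / 5 ≤ (R - t : ℕ) := by
      rw [Nat.cast_sub htR]
      linarith
    calc A / 5 = A / D * (D / 5) := by field_simp
      _ ≤ A / D * (R - t : ℕ) := by gcongr
  have hsplit : (2 : ℝ) ^ (A / 5) = 2 ^ (A / 7) * 2 ^ (2 * A / 35) := by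
    rw [← Real.rpow_add (by norm_num)]
    congr 1
    ring
  have h7 : (1 : ℝ) ≤ 2 ^ (A / 7) := Real.one_le_rpow (by norm_num) (by positivity)
  have hBig : 2 ^ (A / 7) * (16 * D ^ 2) ≤ (B.card : ℝ) := by
    rw [hsplit] at hBcard
    exact (mul_le_mul_of_nonneg_left hbig (by positivity)).trans hBcard
  set T := 500 * Real.log n / (D * (2 : ℝ) ^ E) with hTdef
  have hT0 : 0 ≤ T := by positivity
  have key : HasWitnesses G p (2 * (T / 4) + 2 * (A / (4 * D))) t := by
    refine hasWitnesses_of_reachSet hdisj (by simp [hB]) hJ (by positivity) (by positivity) ?_ ?_ ?_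
    · refine lt_of_lt_of_le ?_ (two_rpow_le_one_add_pow (by positivity) (by linarith) J)
      have hJ1 : D * 2 ^ E / 2 ≤ J := by
        have h1 : D * 2 ^ E < J + 1 := Nat.lt_floor_add_one _
        have h2 : (1 : ℝ) ≤ 2 ^ E := Real.one_le_rpow (by norm_num) (by linarith)
        have h3 : D * 1 ≤ D * 2 ^ E := by gcongr
        linarith
      have h2 : 2 * Real.log n ≤ T / 4 * J := by
        calc 2 * Real.log n ≤ T / 4 * (D * 2 ^ E / 2) := by
              rw [hTdef]; field_simp; linarith
          _ ≤ T / 4 * J := by gcongr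
      rw [Real.rpow_def_of_pos (by norm_num)]
      calc n / 2 < n := by linarith
        _ = Real.exp (Real.log n) := (Real.exp_log (by linarith)).symm
        _ ≤ _ := by
          refine Real.exp_le_exp.2 ?_
          have h3 := Real.log_two_gt_d9
          have h4 : 0.69 * (2 * Real.log n) ≤ Real.log 2 * (T / 4 * J) := by
            gcongr
            linarith
          linarith
    · have h1 : (2 * t : ℝ) ≤ B.card := by
        have : 1 * (16 * D ^ 2) ≤ 2 ^ (A / 7) * (16 * D ^ 2) := by gcongr
        nlinarith
      exact_mod_cast h1
    · have h1 : (C.card : ℝ) + t ≤ 4 * D * 2 ^ (A / 7) := by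
        have h2 : D * 1 ≤ D * (2 : ℝ) ^ (A / 7) := by gcongr
        have h3 : 1 * (2 : ℝ) ^ (A / 7) ≤ D * (2 : ℝ) ^ (A / 7) := by gcongr; linarith
        linarith
      calc (C.card : ℝ) + t ≤ 4 * D * 2 ^ (A / 7) := h1
        _ = 1 / (4 * D) * (2 ^ (A / 7) * (16 * D ^ 2)) := by field_simp; norm_num
        _ ≤ A / (4 * D) * B.card := by gcongr
  refine key.mono ?_
  have h1 := le_max_left (A / D) T
  have h2 := le_max_right (A / D) T
  have h3 : A / (4 * D) = A / D / 4 := by field_simp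
  rw [h3]
  linarith

lemma hasWitnesses_of_exp_bound [DecidableRel G.Adj] {δ : ℝ} (h : IsHyp G δ) (hG : G.Connected)
    (hδ : 1 / 2 ≤ δ) {d : ℕ} (hd2 : 2 < d) (hd : ∀ v, G.degree v ≤ d) {p q : V} {A E : ℝ}
    (hA : 1 ≤ A) (hAD : A ≤ G.dist p q) (hE : 5 ≤ E)
    (hEA : E * (28 * δ * logb 2 (2 * d)) = A) (hD : 100 ≤ G.dist p q)
    (hbig : 16 * (G.dist p q : ℝ) ^ 2 ≤ (2 : ℝ) ^ (2 * A / 35)) (hn : 2 ≤ Fintype.card V)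
    (hT : 500 * Real.log (Fintype.card V) / ((G.dist p q : ℝ) * (2 : ℝ) ^ E) ≤ 2) {t : ℕ}
    (ht : 56 * (t : ℝ) ≤ A + 56) :
    HasWitnesses G p (max (A / G.dist p q)
      (500 * Real.log (Fintype.card V) / ((G.dist p q : ℝ) * (2 : ℝ) ^ E))) t ∨
    HasWitnesses G q (max (A / G.dist p q)
      (500 * Real.log (Fintype.card V) / ((G.dist p q : ℝ) * (2 : ℝ) ^ E))) t := by
  have hδ0 : 0 < δ := by linarith
  have hd2' : (2 : ℝ) < d := by exact_mod_cast hd2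
  have hL : 2 ≤ logb 2 (2 * d) := by
    rw [Real.le_logb_iff_rpow_le (by norm_num) (by positivity)]
    norm_num
    linarith
  set L := logb 2 (2 * d) with hLdef
  set α := 4 * δ * E with hα
  have hα0 : 0 ≤ α := by positivity
  have hαL : L * α = A / 7 := by rw [← hEA, hα]; ring
  have hαA : α ≤ A / 14 := by
    have : 2 * α ≤ L * α := by gcongr
    linarith
  have hDδ : 280 * δ ≤ G.dist p q := by
    have : 5 * (28 * δ * 2) ≤ E * (28 * δ * L) := by gcongr
    linarith
  set Δ := G.dist p q with hΔ
  have hm : ∀ i : ℕ, ∃ m, i ≤ Δ → G.dist p m = i ∧ G.dist q m + i = Δ := by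
    intro i
    by_cases hi : i ≤ Δ
    · obtain ⟨m, hm⟩ := exists_dist_eq hG hi
      exact ⟨m, fun _ => hm⟩
    · exact ⟨p, fun h => absurd h hi⟩
  choose m hm using hm
  set I := (Finset.range (Δ + 1)).filter fun i => Δ ≤ 3 * i ∧ 3 * i ≤ 2 * Δ with hI
  set C := I.biUnion fun i => distBall G (m i) ⌊α⌋₊ with hC
  have hmemI : ∀ i, i ∈ I ↔ Δ ≤ 3 * i ∧ 3 * i ≤ 2 * Δ := by
    intro i
    simp only [hI, Finset.mem_filter, Finset.mem_range]
    omega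
  have hmemC : ∀ v, v ∈ C ↔ ∃ i ∈ I, (G.dist (m i) v : ℝ) ≤ α := by
    intro v
    simp only [hC, Finset.mem_biUnion, mem_distBall, Nat.le_floor_iff hα0]
  have hout : ∀ i ∈ I, ∀ v, v ∉ C → α ≤ G.dist v (m i) := by
    intro i hi v hv
    by_contra! hlt
    rw [G.dist_comm] at hlt
    exact hv ((hmemC v).2 ⟨i, hi, hlt.le⟩)
  have hCcard : (C.card : ℝ) ≤ ((Δ : ℝ) + 1) * (2 : ℝ) ^ (A / 7) := by
    have h1 : C.card ≤ (Δ + 1) * (d + 1) ^ ⌊α⌋₊ := by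
      refine (Finset.card_biUnion_le_card_mul _ _ _ fun i _ => card_distBall_le hG hd _ _).trans ?_
      exact Nat.mul_le_mul_right _ ((Finset.card_filter_le _ _).trans (by simp))
    have h2 : ((d : ℝ) + 1) ^ ⌊α⌋₊ ≤ 2 ^ (A / 7) := by
      calc ((d : ℝ) + 1) ^ ⌊α⌋₊ ≤ (2 * d : ℝ) ^ ⌊α⌋₊ := by gcongr; linarith
        _ = (2 * d : ℝ) ^ (⌊α⌋₊ : ℝ) := (Real.rpow_natCast _ _).symm
        _ ≤ (2 * d : ℝ) ^ α :=
          Real.rpow_le_rpow_of_exponent_le (by linarith) (Nat.floor_le hα0)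
        _ = 2 ^ (A / 7) := by
          rw [← hαL, Real.rpow_mul zero_le_two, hLdef,
            Real.rpow_logb zero_lt_two (by norm_num) (by positivity)]
    calc (C.card : ℝ) ≤ ((Δ : ℝ) + 1) * ((d : ℝ) + 1) ^ ⌊α⌋₊ := by exact_mod_cast h1
      _ ≤ _ := by gcongr
  have hfar : ∀ r : V, (∀ i ∈ I, Δ ≤ 3 * G.dist r (m i)) → Disjoint (distBall G r (Δ / 4)) C := by
    intro r hr
    rw [Finset.disjoint_left]
    intro v hv hvC
    obtain ⟨i, hi, hiα⟩ := (hmemC v).1 hvC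
    have h1 := dist_triangle_real hG r v (m i)
    rw [G.dist_comm (u := v)] at h1
    have h2 : (Δ : ℝ) ≤ 3 * G.dist r (m i) := by exact_mod_cast hr i hi
    have h3 : 4 * G.dist r v ≤ Δ := by
      have := mem_distBall.1 hv
      omega
    have h4 : 4 * (G.dist r v : ℝ) ≤ Δ := by exact_mod_cast h3
    linarith
  have hp := hfar p fun i hi => by
    have := (hmemI i).1 hi
    rw [(hm i (by omega)).1]
    exact this.1
  have hq := hfar q fun i hi => by
    have := (hmemI i).1 hi
    have := (hm i (by omega)).2
    omega
  have hsep : Disjoint (reachSet G C (distBall G p (Δ / 4)) ⌊(Δ : ℝ) * 2 ^ E⌋₊)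
      (reachSet G C (distBall G q (Δ / 4)) ⌊(Δ : ℝ) * 2 ^ E⌋₊) := by
    rw [Finset.disjoint_left]
    intro v hvp hvq
    have h1 := h.dist_lt_of_mem_reachSet hG hδ hE hDδ (fun i h1 h2 =>
      have hi := (hmemI i).2 ⟨h1, h2⟩
      ⟨m i, (hm i (by omega)).1, (hm i (by omega)).2, hout i hi⟩) hvp
    have hcomm : G.dist q p = Δ := G.dist_comm
    have h2 := h.dist_lt_of_mem_reachSet hG hδ (p := q) (q := p) hE (by rw [hcomm]; exact hDδ)
      (C := C) (v := v) (fun i h1 h2 => by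
        rw [hcomm] at h1 h2 ⊢
        have hi := (hmemI (Δ - i)).2 ⟨by omega, by omega⟩
        have := hm (Δ - i) (by omega)
        exact ⟨m (Δ - i), by omega, by omega, hout _ hi⟩) (by rw [hcomm]; exact hvq)
    omega
  rcases two_mul_card_le_or_of_disjoint hsep with h1 | h1
  · exact Or.inl (hasWitnesses_of_separator hG hA hAD hE hD hbig hn hT ht hCcard hp h1)
  · right
    have hcomm : Δ = G.dist q p := G.dist_comm
    clear_value C I L α Δ
    subst hcomm
    exact hasWitnesses_of_separator hG hA hAD hE hD hbig hn hT ht hCcard hq h1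

end Cases

lemma exists_sq_le_two_rpow {μ : ℝ} (hμ : 0 < μ) :
    ∃ D₀ : ℕ, 100 ≤ D₀ ∧ ∀ D : ℝ, D₀ ≤ D → 16 * D ^ 2 ≤ (2 : ℝ) ^ (2 * D ^ μ / 35) := by
  obtain ⟨a, ha⟩ := Filter.eventually_atTop.1
    ((isLittleO_log_rpow_atTop hμ).def (show (0 : ℝ) < 0.01 by norm_num))
  refine ⟨max 100 ⌈a⌉₊, le_max_left _ _, fun D hD => ?_⟩
  rw [Nat.cast_max, max_le_iff] at hD
  have hD1 : (100 : ℝ) ≤ D := by exact_mod_cast hD.1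
  have h1 := ha D ((Nat.le_ceil a).trans hD.2)
  rw [Real.norm_of_nonneg (Real.log_nonneg (by linarith)),
    Real.norm_of_nonneg (by positivity)] at h1
  calc 16 * D ^ 2 ≤ D * D ^ 2 := by gcongr; linarith
    _ = D ^ 3 := by ring
    _ = Real.exp (Real.log (D ^ 3)) := (Real.exp_log (by positivity)).symm
    _ ≤ Real.exp (Real.log 2 * (2 * D ^ μ / 35)) := by
      rw [Real.log_pow]
      refine Real.exp_le_exp.2 ?_
      have h2 : 0.69 * (2 * D ^ μ / 35) ≤ Real.log 2 * (2 * D ^ μ / 35) := by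
        have := Real.log_two_gt_d9
        gcongr
        linarith
      have h3 : 0 ≤ D ^ μ := by positivity
      push_cast
      linarith
    _ = _ := (Real.rpow_def_of_pos zero_lt_two _).symm

lemma dist_lt_card {V : Type*} [Fintype V] {G : SimpleGraph V} (hG : G.Connected) (p q : V) :
    G.dist p q < Fintype.card V := by
  obtain ⟨w, hw, hl⟩ := hG.exists_path_of_dist p q
  exact hl ▸ hw.length_lt

lemma hasWitnesses_main {V : Type*} [Fintype V] {G : SimpleGraph V} [DecidableRel G.Adj]
    {μ δ : ℝ} (hμ0 : 0 < μ) (hμ1 : μ < 1) (h : IsHyp G δ) (hG : G.Connected)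
    (hδ : 1 / 2 ≤ δ) {d : ℕ} (hd2 : 2 < d) (hd : ∀ v, G.degree v ≤ d) {p q : V}
    (hpq : 1 ≤ G.dist p q) {D₀ : ℕ} (hD₀ : 100 ≤ D₀)
    (hbig : ∀ D : ℝ, D₀ ≤ D → 16 * D ^ 2 ≤ (2 : ℝ) ^ (2 * D ^ μ / 35))
    (hn : 100 ≤ Fintype.card V)
    (hX : (D₀ : ℝ) * 2 ^ (D₀ : ℝ) ≤ Real.log ((Fintype.card V : ℝ) / 2)) {t : ℕ}
    (ht : 56 * (t : ℝ) ≤ (G.dist p q : ℝ) ^ μ + 56) {T : ℝ}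
    (hT : T = min (8 * Real.log ((Fintype.card V : ℝ) / 2) / (G.dist p q : ℝ))
      (max ((1 / (G.dist p q : ℝ)) ^ (1 - μ))
        (500 * Real.log (Fintype.card V) / ((G.dist p q : ℝ) *
          (2 : ℝ) ^ (((G.dist p q : ℝ)) ^ μ / (28 * δ * logb 2 (2 * d))))))) :
    HasWitnesses G p T t ∨ HasWitnesses G q T t := by
  have hD1 : (1 : ℝ) ≤ G.dist p q := by exact_mod_cast hpq
  have hn' : (100 : ℝ) ≤ Fintype.card V := by exact_mod_cast hn
  have hDn : (G.dist p q : ℝ) ≤ Fintype.card V := by exact_mod_cast (dist_lt_card hG p q).le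
  have hlog : Real.log ((Fintype.card V : ℝ) / 2) ≤ Real.log (Fintype.card V) :=
    Real.log_le_log (by linarith) (by linarith)
  have hX0 : 0 < Real.log ((Fintype.card V : ℝ) / 2) := Real.log_pos (by linarith)
  have hd2' : (2 : ℝ) < d := by exact_mod_cast hd2
  have hL : 2 ≤ logb 2 (2 * d) := by
    rw [Real.le_logb_iff_rpow_le (by norm_num) (by positivity)]
    norm_num
    linarith
  have hden : 28 ≤ 28 * δ * logb 2 (2 * d) := by
    calc (28 : ℝ) = 28 * (1 / 2) * 2 := by norm_num
      _ ≤ 28 * δ * logb 2 (2 * d) := by gcongr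
  have hpow : (1 / (G.dist p q : ℝ)) ^ (1 - μ) = (G.dist p q : ℝ) ^ μ / G.dist p q := by
    rw [one_div, Real.inv_rpow (by positivity), Real.rpow_sub (by positivity), Real.rpow_one,
      inv_div]
  rw [hpow] at hT
  have hA1 : 1 ≤ (G.dist p q : ℝ) ^ μ := Real.one_le_rpow hD1 hμ0.le
  have hAD : (G.dist p q : ℝ) ^ μ ≤ G.dist p q := by
    simpa using Real.rpow_le_rpow_of_exponent_le hD1 hμ1.le
  set A := (G.dist p q : ℝ) ^ μ with hA
  set E := A / (28 * δ * logb 2 (2 * d)) with hE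
  have hEA : E * (28 * δ * logb 2 (2 * d)) = A := div_mul_cancel₀ _ (by linarith)
  rcases le_or_gt 2 T with h2 | h2
  · refine Or.inl (hasWitnesses_of_two_le p h2 hn ?_)
    have : 56 * (t : ℝ) ≤ Fintype.card V + 56 := by linarith
    exact_mod_cast this
  have hDD₀ : D₀ ≤ G.dist p q := by
    by_contra! hlt
    have hlt' : (G.dist p q : ℝ) ≤ D₀ := by exact_mod_cast hlt.le
    have hE1 : E ≤ D₀ := (div_le_self (by linarith) (by linarith)).trans (hAD.trans hlt')
    have hDE : (G.dist p q : ℝ) * 2 ^ E ≤ D₀ * 2 ^ (D₀ : ℝ) := by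
      gcongr
      norm_num
    have h3 : (1 : ℝ) ≤ 2 ^ (D₀ : ℝ) := Real.one_le_rpow (by norm_num) (by positivity)
    have h4 : (D₀ : ℝ) * 1 ≤ D₀ * 2 ^ (D₀ : ℝ) := by gcongr
    refine h2.not_ge ?_
    rw [hT]
    refine le_min ?_ (le_max_of_le_right ?_)
    · rw [le_div_iff₀ (by linarith)]
      linarith
    · rw [le_div_iff₀ (by positivity)]
      linarith
  have hDD₀' : (D₀ : ℝ) ≤ G.dist p q := by exact_mod_cast hDD₀
  rcases le_or_gt (8 * Real.log ((Fintype.card V : ℝ) / 2) / (G.dist p q : ℝ)) (max (A / G.dist p q)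
      (500 * Real.log (Fintype.card V) / ((G.dist p q : ℝ) * (2 : ℝ) ^ E))) with hle | hlt
  · rw [min_eq_left hle] at hT
    rw [hT] at h2 ⊢
    exact hasWitnesses_of_log_bound hG (hD₀.trans hDD₀) (by linarith) hX0 h2.le
  · rw [min_eq_right hlt.le] at hT
    rw [hT] at h2 ⊢
    have hT' := (le_max_right _ _).trans_lt hlt
    have hE5 : 5 ≤ E := by
      by_contra! hE5
      have h3 : (2 : ℝ) ^ E ≤ 2 ^ (5 : ℝ) :=
        Real.rpow_le_rpow_of_exponent_le (by norm_num) hE5.le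
      norm_num at h3
      rw [div_lt_div_iff₀ (by positivity) (by positivity)] at hT'
      have h4 : 8 * Real.log ((Fintype.card V : ℝ) / 2) * (G.dist p q * 2 ^ E) ≤
          8 * Real.log (Fintype.card V) * (G.dist p q * 32) := by gcongr
      have h5 : 0 ≤ Real.log (Fintype.card V) * G.dist p q := by positivity
      linarith
    exact hasWitnesses_of_exp_bound h hG hδ hd2 hd hA1 hAD hE5 hEA (hD₀.trans hDD₀)
      (hbig _ hDD₀') (by omega) ((le_max_right _ _).trans h2.le) ht

theorem nested_family_of_witnesses (μ : ℝ) (hμ0 : 0 < μ) (hμ1 : μ < 1) :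
    ∃ n₀ : ℕ, ∀ (V : Type) [Fintype V] (G : SimpleGraph V) [DecidableRel G.Adj]
      (δ : ℝ) (d : ℕ) (p q : V),
      G.Connected → n₀ ≤ Fintype.card V → (1 / 2 : ℝ) ≤ δ → IsHyp G δ → 2 < d →
      (∀ v : V, G.degree v ≤ d) → 1 ≤ G.dist p q →
      ∃ S : Fin (max ⌊((G.dist p q : ℝ)) ^ μ / (56 * logb 2 d)⌋₊ 1) → Finset V,
        (S ⟨0, by positivity⟩).Nonempty ∧
        (∀ i, S i ≠ Finset.univ) ∧
        (∀ i j, i < j → S i ⊂ S j) ∧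
        (∀ i, 2 * (S i).card ≤ Fintype.card V) ∧
        (∀ i, hexp G (S i) ≤
            min (8 * Real.log ((Fintype.card V : ℝ) / 2) / (G.dist p q : ℝ))
              (max ((1 / (G.dist p q : ℝ)) ^ (1 - μ))
                (500 * Real.log (Fintype.card V) /
                  ((G.dist p q : ℝ) *
                    (2 : ℝ) ^ (((G.dist p q : ℝ)) ^ μ / (28 * δ * logb 2 (2 * d))))))) ∧
        ((∀ i, p ∈ S i) ∨ (∀ i, q ∈ S i)) := by
  obtain ⟨D₀, hD₀, hbig⟩ := exists_sq_le_two_rpow hμ0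
  refine ⟨max 100 ⌈2 * Real.exp ((D₀ : ℝ) * 2 ^ (D₀ : ℝ))⌉₊, ?_⟩
  intro V _ G _ δ d p q hG hn hδ hyp hd2 hd hpq
  have hn1 : 100 ≤ Fintype.card V := (le_max_left _ _).trans hn
  have hn2 : 2 * Real.exp ((D₀ : ℝ) * 2 ^ (D₀ : ℝ)) ≤ Fintype.card V :=
    Nat.ceil_le.1 ((le_max_right _ _).trans hn)
  have hX : (D₀ : ℝ) * 2 ^ (D₀ : ℝ) ≤ Real.log ((Fintype.card V : ℝ) / 2) := by
    have : (100 : ℝ) ≤ Fintype.card V := by exact_mod_cast hn1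
    rw [Real.le_log_iff_exp_le (by linarith)]
    linarith
  have ht : 56 * ((max ⌊((G.dist p q : ℝ)) ^ μ / (56 * logb 2 d)⌋₊ 1 : ℕ) : ℝ) ≤
      (G.dist p q : ℝ) ^ μ + 56 := by
    have hlogd : 1 ≤ logb 2 d := by
      have hd2' : (2 : ℝ) < d := by exact_mod_cast hd2
      rw [Real.le_logb_iff_rpow_le (by norm_num) (by linarith)]
      simpa using hd2'.le
    have hA : 0 ≤ (G.dist p q : ℝ) ^ μ := by positivity
    have h1 : (⌊((G.dist p q : ℝ)) ^ μ / (56 * logb 2 d)⌋₊ : ℝ) ≤ (G.dist p q : ℝ) ^ μ / 56 :=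
      (Nat.floor_le (by positivity)).trans
        (div_le_div_of_nonneg_left hA (by norm_num) (by linarith))
    rw [Nat.cast_max, Nat.cast_one]
    have h2 := max_le (h1.trans (le_add_of_nonneg_right zero_le_one))
      (le_add_of_nonneg_left (show 0 ≤ (G.dist p q : ℝ) ^ μ / 56 by positivity))
    linarith
  have hne : ∀ S : Finset V, 2 * S.card ≤ Fintype.card V → S ≠ Finset.univ := by
    rintro S hS rfl
    rw [Finset.card_univ] at hS
    omega
  rcases hasWitnesses_main hμ0 hμ1 hyp hG hδ hd2 hd hpq hD₀ hbig hn1 hX ht rfl with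
    ⟨S, h1, h2, h3, h4⟩ | ⟨S, h1, h2, h3, h4⟩
  · exact ⟨S, ⟨p, h4 _⟩, fun i => hne _ (h2 i), h1, h2, h3, Or.inl h4⟩
  · exact ⟨S, ⟨q, h4 _⟩, fun i => hne _ (h2 i), h1, h2, h3, Or.inr h4⟩

end PaperHyp
end

section
/- Let G be a finite simple connected undirected graph on n ≥ 4 nodes, let 0 < μ < 1 be a constant, and let p, q be nodes with Δ = dist_G(p,q) such that Δ^μ ≥ 8·ln(n/2) and |B_G(p, ⌈Δ/2⌉)| ≤ n/2. Then there exist at least ⌊Δ/4⌋ integers 0 ≤ r₁ < r₂ < ⋯ < r_{⌊Δ/4⌋} < Δ/2 such that h_G(B_G(p, r_i)) ≤ 8·ln(n/2)/Δ for every i; in particular the balls B_G(p,r₁) ⊊ B_G(p,r₂) ⊊ ⋯ ⊊ B_G(p,r_{⌊Δ/4⌋}) form a nested family of witnesses of this node-expansion bound. -/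
open scoped Classical
open Real

namespace PaperHyp

/-- The ball B_G(u,r) of (real) radius r around u. -/
noncomputable def ball {V : Type*} (G : SimpleGraph V) [Fintype V] (u : V) (r : ℝ) : Finset V :=
  Finset.univ.filter fun v => (G.dist u v : ℝ) ≤ r

theorem mem_ball_natCast {V : Type*} (G : SimpleGraph V) [Fintype V] (u v : V) (r : ℕ) :
    v ∈ ball G u (r : ℝ) ↔ G.dist u v ≤ r := by
  simp [ball]

theorem self_mem_ball {V : Type*} (G : SimpleGraph V) [Fintype V] (u : V) (r : ℕ) :
    u ∈ ball G u (r : ℝ) := by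
  simp [mem_ball_natCast]

theorem card_ball_pos {V : Type*} (G : SimpleGraph V) [Fintype V] (u : V) (r : ℕ) :
    0 < (ball G u (r : ℝ)).card :=
  Finset.card_pos.2 ⟨u, self_mem_ball G u r⟩

theorem ball_subset_ball {V : Type*} (G : SimpleGraph V) [Fintype V] (u : V) {r s : ℕ}
    (h : r ≤ s) : ball G u (r : ℝ) ⊆ ball G u (s : ℝ) := fun v hv => by
  rw [mem_ball_natCast] at *
  exact hv.trans h

/-- Every distance up to `dist u v` is attained in a connected graph. -/
theorem exists_dist_eq_s2 {V : Type*} {G : SimpleGraph V} (hG : G.Connected) {u v : V} {k : ℕ}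
    (hk : k ≤ G.dist u v) : ∃ w, G.dist u w = k := by
  obtain ⟨p, hp⟩ := hG.exists_walk_length_eq_dist u v
  refine ⟨p.getVert k, ?_⟩
  have h1 := SimpleGraph.dist_le (p.take k)
  have h2 := SimpleGraph.dist_le (p.drop k)
  have h3 := hG.dist_triangle (u := u) (v := p.getVert k) (w := v)
  rw [SimpleGraph.Walk.take_length] at h1
  rw [SimpleGraph.Walk.drop_length] at h2
  omega

theorem ball_ssubset_ball {V : Type*} {G : SimpleGraph V} [Fintype V] (hG : G.Connected)
    {u v : V} {r s : ℕ} (hrs : r < s) (hs : s ≤ G.dist u v) :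
    ball G u (r : ℝ) ⊂ ball G u (s : ℝ) := by
  obtain ⟨w, hw⟩ := exists_dist_eq_s2 hG hs
  refine Finset.ssubset_iff_subset_ne.2 ⟨ball_subset_ball G u hrs.le, fun h => ?_⟩
  have hmem : w ∈ ball G u (r : ℝ) := h ▸ (mem_ball_natCast G u w s).2 hw.le
  rw [mem_ball_natCast] at hmem
  omega

theorem card_ball_add_card_nodeBoundary_le {V : Type*} {G : SimpleGraph V} [Fintype V]
    (hG : G.Connected) (u : V) (r : ℕ) :
    (ball G u (r : ℝ)).card + (nodeBoundary G (ball G u (r : ℝ))).card ≤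
      (ball G u ((r + 1 : ℕ) : ℝ)).card := by
  rw [← Finset.card_union_of_disjoint]
  · refine Finset.card_le_card (Finset.union_subset (ball_subset_ball G u r.le_succ) ?_)
    intro w hw
    obtain ⟨-, v, hv, hadj⟩ := (Finset.mem_filter.1 hw).2
    rw [mem_ball_natCast] at *
    have h1 := hG.dist_triangle (u := u) (v := v) (w := w)
    have h2 := SimpleGraph.dist_eq_one_iff_adj.2 hadj.symm
    omega
  · exact Finset.disjoint_left.2 fun w hw hw' => (Finset.mem_filter.1 hw').2.1 hw

/-- A ball grows by a factor `1 + ε` at every smaller radius whose node expansion exceeds `ε`. -/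
theorem one_add_pow_le_card_ball {V : Type*} {G : SimpleGraph V} [Fintype V]
    (hG : G.Connected) (u : V) {ε : ℝ} (hε : 0 ≤ ε) (R : ℕ) :
    (1 + ε) ^ ((Finset.range R).filter fun r : ℕ => ¬ hexp G (ball G u (r : ℝ)) ≤ ε).card ≤
      ((ball G u (R : ℝ)).card : ℝ) := by
  induction R with
  | zero => simpa using card_ball_pos G u 0
  | succ R ih =>
    have hstep : ((ball G u (R : ℝ)).card : ℝ) + (nodeBoundary G (ball G u (R : ℝ))).card ≤
        ((ball G u ((R + 1 : ℕ) : ℝ)).card : ℝ) := by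
      exact_mod_cast card_ball_add_card_nodeBoundary_le hG u R
    rw [Finset.range_add_one, Finset.filter_insert]
    split_ifs with h
    · have : (0 : ℝ) ≤ (nodeBoundary G (ball G u (R : ℝ))).card := by positivity
      linarith
    · rw [Finset.card_insert_of_notMem (by simp), pow_succ]
      have hpos : (0 : ℝ) < (ball G u (R : ℝ)).card := by exact_mod_cast card_ball_pos G u R
      rw [not_le, hexp, lt_div_iff₀ hpos] at h
      have := mul_le_mul_of_nonneg_right ih (by positivity : 0 ≤ 1 + ε)
      linarith

theorem half_le_log_one_add {x : ℝ} (h0 : 0 ≤ x) (h1 : x ≤ 1) : x / 2 ≤ Real.log (1 + x) := by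
  refine le_trans ?_ (Real.one_sub_inv_le_log_of_pos (by linarith : 0 < 1 + x))
  have : 1 - (1 + x)⁻¹ = x / (1 + x) := by
    field_simp
    ring
  rw [this]
  exact div_le_div_of_nonneg_left h0 (by linarith) (by linarith)

theorem easy_nested_balls (V : Type) [Fintype V] (G : SimpleGraph V) (μ : ℝ) (p q : V)
    (hconn : G.Connected) (hn : 4 ≤ Fintype.card V) (hμ0 : 0 < μ) (hμ1 : μ < 1)
    (hΔμ : 8 * Real.log ((Fintype.card V : ℝ) / 2) ≤ ((G.dist p q : ℝ)) ^ μ)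
    (hhalf : 2 * (ball G p (⌈(G.dist p q : ℝ) / 2⌉₊ : ℝ)).card ≤ Fintype.card V) :
    ∃ r : Fin (G.dist p q / 4) → ℕ,
      StrictMono r ∧
      (∀ i, (r i : ℝ) < (G.dist p q : ℝ) / 2) ∧
      (∀ i j, i < j → ball G p (r i : ℝ) ⊂ ball G p (r j : ℝ)) ∧
      (∀ i, hexp G (ball G p (r i : ℝ)) ≤
          8 * Real.log ((Fintype.card V : ℝ) / 2) / (G.dist p q : ℝ)) := by
  set L := Real.log ((Fintype.card V : ℝ) / 2) with hL
  have hn' : (4 : ℝ) ≤ Fintype.card V := by exact_mod_cast hn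
  have hLpos : 0 < L := Real.log_pos (by linarith)
  have hΔ : 0 < G.dist p q := by
    refine Nat.pos_of_ne_zero fun h => ?_
    rw [h, Nat.cast_zero, Real.zero_rpow hμ0.ne'] at hΔμ
    linarith
  have hΔ1 : (1 : ℝ) ≤ G.dist p q := by exact_mod_cast hΔ
  have hΔpos : (0 : ℝ) < G.dist p q := by linarith
  set ε := 8 * L / (G.dist p q : ℝ) with hεdef
  have hε0 : 0 < ε := by positivity
  have hε1 : ε ≤ 1 := by
    rw [hεdef, div_le_one hΔpos]
    exact hΔμ.trans ((Real.rpow_le_rpow_of_exponent_le hΔ1 hμ1.le).trans_eq (Real.rpow_one _))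
  set R := ⌈(G.dist p q : ℝ) / 2⌉₊ with hR
  have hRΔ : G.dist p q ≤ 2 * R := by
    have : (G.dist p q : ℝ) / 2 ≤ R := Nat.le_ceil _
    have : (G.dist p q : ℝ) ≤ 2 * R := by linarith
    exact_mod_cast this
  set bad := (Finset.range R).filter fun r : ℕ => ¬ hexp G (ball G p (r : ℝ)) ≤ ε with hbad
  set good := (Finset.range R).filter fun r : ℕ => hexp G (ball G p (r : ℝ)) ≤ ε with hgood
  have hsum : good.card + bad.card = R := by
    rw [hgood, hbad, Finset.card_filter_add_card_filter_not, Finset.card_range]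
  have hbad_card : 4 * bad.card ≤ G.dist p q := by
    have hpow : (1 + ε) ^ bad.card ≤ (Fintype.card V : ℝ) / 2 := by
      refine (one_add_pow_le_card_ball hconn p hε0.le R).trans ?_
      have : (2 : ℝ) * (ball G p (R : ℝ)).card ≤ Fintype.card V := by exact_mod_cast hhalf
      linarith
    have hlog := Real.log_le_log (by positivity) hpow
    rw [Real.log_pow] at hlog
    have hmul : (bad.card : ℝ) * (ε / 2) ≤ L :=
      (mul_le_mul_of_nonneg_left (half_le_log_one_add hε0.le hε1) (by positivity)).trans hlog
    have hεΔ : ε * G.dist p q = 8 * L := div_mul_cancel₀ _ hΔpos.ne'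
    have hle : (4 * bad.card : ℝ) * L ≤ G.dist p q * L := by
      have := mul_le_mul_of_nonneg_right hmul hΔpos.le
      linear_combination this - (bad.card : ℝ) / 2 * hεΔ
    exact_mod_cast le_of_mul_le_mul_right hle hLpos
  have hcard : G.dist p q / 4 ≤ good.card := by omega
  let r := good.orderEmbOfCardLe hcard
  have hr : ∀ i, r i < R ∧ hexp G (ball G p (r i : ℝ)) ≤ ε := fun i => by
    simpa [hgood] using good.orderEmbOfCardLe_mem hcard i
  have hlt : ∀ i, (r i : ℝ) < (G.dist p q : ℝ) / 2 := fun i => Nat.lt_ceil.1 (hr i).1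
  refine ⟨r, r.strictMono, hlt, fun i j hij => ?_, fun i => (hr i).2⟩
  refine ball_ssubset_ball hconn (v := q) (r.strictMono hij) ?_
  have : (r j : ℝ) ≤ G.dist p q := by linarith [hlt j]
  exact_mod_cast this

end PaperHyp
end

section
/- For every constant 0 < μ < 1 there is an n₀ such that the following holds for all n ≥ n₀. Let G be a connected δ-hyperbolic graph (δ ≥ 1/2) on n nodes with maximum degree d > 2, let p, q be nodes with Δ = dist_G(p,q), and let τ be a positive integer with τ ≤ Δ/4, Δ/τ > 6, and (Δ/(60τ))·2^{ (Δ/τ)^μ/(28·δ·log(2d)) } > Δ/τ + 2Δ. Let p = p₁, p₂, …, p_{τ+1} = q be nodes in this order on a fixed shortest p–q path with dist_G(p_i, p_{i+1}) = Δ/τ for every i. For an index i, let ℓ_i, r_i be the nodes on the p_i–p_{i+1} portion of this geodesic with dist_G(p_i,ℓ_i) = dist_G(ℓ_i,r_i) = dist_G(r_i,p_{i+1}) = Δ/(3τ), and for a real α with 1/(28·(Δ/τ)^{1−μ}·log(2d)) ≤ α ≤ 1/(14·(Δ/τ)^{1−μ}·log(2d)) let C_i(α) = { u ∈ V : ∃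 v on the ℓ_i–r_i portion of the geodesic with dist_G(u,v) = ⌈α·Δ/τ⌉ }. Let i ≤ j − 2 be two indices, let α_i, α_j be in the above range, let C_i = C_i(α_i) and C_j = C_j(α_j), and let a_i ≤ dist_{G_{−C_i}}(p_i, p_{i+1})/2 and a_j ≤ dist_{G_{−C_j}}(p_j, p_{j+1})/2. Then every node u ∈ B_{G_{−C_i}}(p_i, a_i) ∩ B_{G_{−C_j}}(p_j, a_j) satisfies dist_{G_{−C_j}}(u, p_j) > Δ/(2τ). -/
open scoped Classical
open Real

namespace PaperHyp

/-- Distance in the node-deleted subgraph G₋W: the infimum (in ℕ∞, so ∞ if none exists) of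
lengths of walks of G between u and v all of whose nodes avoid W. -/
noncomputable def delDist {V : Type*} (G : SimpleGraph V) (W : Set V) (u v : V) : ℕ∞ :=
  ⨅ p : {p : G.Walk u v // ∀ x ∈ p.support, x ∉ W}, (p.1.length : ℕ∞)

section

open SimpleGraph

variable {V : Type*} {G : SimpleGraph V}

/-- A finite bound on the deleted distance is witnessed by a walk avoiding the deleted set. -/
lemma exists_walk_of_delDist_le {W : Set V} {u v : V} {a : ℕ} (h : delDist G W u v ≤ a) :
    ∃ p : G.Walk u v, (∀ x ∈ p.support, x ∉ W) ∧ p.length ≤ a := by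
  have h1 : delDist G W u v < ((a + 1 : ℕ) : ℕ∞) :=
    lt_of_le_of_lt h (by exact_mod_cast Nat.lt_succ_self a)
  obtain ⟨⟨p, hp⟩, hlt⟩ := iInf_lt_iff.1 h1
  exact ⟨p, hp, Nat.lt_succ_iff.1 (by exact_mod_cast hlt)⟩

lemma delDist_le_length {W : Set V} {u v : V} (p : G.Walk u v) (hp : ∀ x ∈ p.support, x ∉ W) :
    delDist G W u v ≤ p.length :=
  iInf_le (fun p : {p : G.Walk u v // ∀ x ∈ p.support, x ∉ W} => (p.1.length : ℕ∞)) ⟨p, hp⟩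

/-- The portion of a walk between two of its positions. -/
lemma exists_subwalk {p q : V} (w : G.Walk p q) {k m : ℕ} (hkm : k ≤ m) (hm : m ≤ w.length) :
    ∃ r : G.Walk (w.getVert k) (w.getVert m), r.length = m - k ∧
      ∀ x ∈ r.support, ∃ t, k ≤ t ∧ t ≤ m ∧ x = w.getVert t := by
  induction m, hkm using Nat.le_induction with
  | base => exact ⟨Walk.nil, by simp, fun x hx => ⟨k, le_rfl, le_rfl, by simpa using hx⟩⟩
  | succ m hkm ih =>
    obtain ⟨r, hr, hs⟩ := ih (by omega)
    refine ⟨r.concat (w.adj_getVert_succ (by omega)), by rw [Walk.length_concat]; omega, ?_⟩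
    intro x hx
    simp only [Walk.support_concat, List.mem_append, List.mem_singleton] at hx
    rcases hx with hx | hx
    · obtain ⟨t, h1, h2, h3⟩ := hs x hx
      exact ⟨t, h1, by omega, h3⟩
    · exact ⟨m + 1, by omega, le_rfl, hx⟩

lemma dist_getVert_le {p q : V} (w : G.Walk p q) {k m : ℕ} (hkm : k ≤ m) (hm : m ≤ w.length) :
    G.dist (w.getVert k) (w.getVert m) ≤ m - k := by
  obtain ⟨r, hr, -⟩ := exists_subwalk w hkm hm
  exact hr ▸ dist_le r

/-- Positions along a geodesic are at the distance given by their difference. -/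
lemma dist_getVert_of_geodesic (hG : G.Connected) {p q : V} (w : G.Walk p q)
    (hw : w.length = G.dist p q) {k m : ℕ} (hkm : k ≤ m) (hm : m ≤ w.length) :
    G.dist (w.getVert k) (w.getVert m) = m - k := by
  have h1 := dist_getVert_le w (Nat.zero_le k) (hkm.trans hm)
  have h2 := dist_getVert_le w hkm hm
  have h3 := dist_getVert_le w hm le_rfl
  rw [Walk.getVert_zero] at h1
  rw [Walk.getVert_length] at h3
  have h4 := hG.dist_triangle (u := p) (v := w.getVert k) (w := q)
  have h5 := hG.dist_triangle (u := w.getVert k) (v := w.getVert m) (w := q)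
  omega

lemma dist_le_length_of_mem_support {u v x : V} (r : G.Walk u v) (hx : x ∈ r.support) :
    G.dist x v ≤ r.length :=
  (dist_le (r.dropUntil x hx)).trans (r.length_dropUntil_le_length hx)

/-- A walk crossing from outside to inside a ball meets the sphere bounding it. -/
lemma exists_mem_support_dist_eq (hG : G.Connected) {R : ℕ} {v a z : V} (r : G.Walk a z)
    (ha : R ≤ G.dist a v) (hz : G.dist z v ≤ R) : ∃ x ∈ r.support, G.dist x v = R := by
  induction r with
  | nil => exact ⟨_, by simp, le_antisymm hz ha⟩
  | @cons a a' z h r ih =>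
    by_cases he : G.dist a v = R
    · exact ⟨a, by simp, he⟩
    · have h1 := hG.dist_triangle (u := a) (v := a') (w := v)
      rw [dist_eq_one_iff_adj.2 h] at h1
      obtain ⟨x, hx, hxR⟩ := ih (by omega) hz
      exact ⟨x, by simp [hx], hxR⟩

/-- The largest of the three pairwise sums exceeds the next one by at most `2 * δ`. -/
lemma IsHyp.dist_add_dist_le {δ : ℝ} (h : IsHyp G δ) (hδ : 0 ≤ δ) (x y z t : V) :
    (G.dist x y + G.dist z t : ℝ) ≤
      max (G.dist x z + G.dist y t : ℝ) (G.dist x t + G.dist y z) + 2 * δ := by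
  have h1 := h x y z t
  dsimp only at h1
  generalize (G.dist x y + G.dist z t : ℝ) = s₁ at *
  generalize (G.dist x z + G.dist y t : ℝ) = s₂ at *
  generalize (G.dist x t + G.dist y z : ℝ) = s₃ at *
  grind

/-- Two shortest walks with the same ends stay within `2 * δ` of each other. -/
lemma IsHyp.dist_getVert_le {δ : ℝ} (h : IsHyp G δ) (hδ : 0 ≤ δ) {a z v : V} (Q : G.Walk a z)
    (hQ : Q.length ≤ G.dist a z) (hv : G.dist a v + G.dist z v ≤ G.dist a z) :
    (G.dist (Q.getVert (G.dist a v)) v : ℝ) ≤ 2 * δ := by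
  have hm : G.dist a v ≤ Q.length := by
    have := dist_le Q
    omega
  have h1 := PaperHyp.dist_getVert_le Q (Nat.zero_le _) hm
  have h2 := PaperHyp.dist_getVert_le Q hm le_rfl
  rw [Walk.getVert_zero] at h1
  rw [Walk.getVert_length, SimpleGraph.dist_comm] at h2
  have h3 := h.dist_add_dist_le hδ a z (Q.getVert (G.dist a v)) v
  have h4 : max (G.dist a (Q.getVert (G.dist a v)) + G.dist z v : ℝ)
      (G.dist a v + G.dist z (Q.getVert (G.dist a v))) ≤ G.dist a z := by
    apply max_le <;> norm_cast <;> omega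
  linarith

/-- Quantitative bounds on the cylinder radius. -/
lemma two_mul_lt_ceil_and_ceil_lt {μ δ α : ℝ} {d c b D : ℕ} (hμ1 : μ < 1) (hδ : 1 / 2 ≤ δ)
    (hd : 2 < d) (hcb : c = 3 * b) (hc : 6 < c)
    (hexp : (c : ℝ) / 60 * (2 : ℝ) ^ ((c : ℝ) ^ μ / (28 * δ * logb 2 (2 * d))) > c + 2 * (D : ℝ))
    (hα₁ : 1 / (28 * (c : ℝ) ^ (1 - μ) * logb 2 (2 * d)) ≤ α)
    (hα₂ : α ≤ 1 / (14 * (c : ℝ) ^ (1 - μ) * logb 2 (2 * d))) :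
    2 * δ < (⌈α * (c : ℝ)⌉₊ : ℝ) ∧ ⌈α * (c : ℝ)⌉₊ < b := by
  have hc' : (9 : ℝ) ≤ c := by
    have : 9 ≤ c := by omega
    exact_mod_cast this
  have hc0 : (0 : ℝ) < c := by linarith
  have hlog : 2 ≤ logb 2 (2 * d) := by
    have hd' : (3 : ℝ) ≤ d := by exact_mod_cast hd
    rw [le_logb_iff_rpow_le (by norm_num) (by linarith)]
    norm_num
    linarith
  set l := logb 2 (2 * (d : ℝ)) with hl
  have hpow : 1 ≤ (c : ℝ) ^ (1 - μ) := one_le_rpow (by linarith) (by linarith)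
  have hsplit : (c : ℝ) ^ (1 - μ) * (c : ℝ) ^ μ = c := by
    rw [← rpow_add hc0]
    simp
  set y := (c : ℝ) ^ (1 - μ) with hy
  set z := (c : ℝ) ^ μ with hz
  constructor
  · have hX : 2 < z / (28 * δ * l) := by
      have hD : (0 : ℝ) ≤ D := D.cast_nonneg
      have h1 : (2 : ℝ) ^ (2 : ℝ) < (2 : ℝ) ^ (z / (28 * δ * l)) := by
        norm_num
        nlinarith
      exact (rpow_lt_rpow_left_iff (by norm_num)).1 h1
    have hlow : z / (28 * l) ≤ α * c := by
      calc z / (28 * l) = 1 / (28 * y * l) * c := by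
            rw [← hsplit]
            field_simp
        _ ≤ α * c := by gcongr
    have h3 : 2 * δ < z / (28 * l) := by
      rw [lt_div_iff₀ (by positivity)] at hX ⊢
      linarith
    exact h3.trans_le (hlow.trans (Nat.le_ceil _))
  · have hup : α * c ≤ c / 28 := by
      have h1 : 1 / (14 * y * l) ≤ 1 / 28 := by
        apply one_div_le_one_div_of_le (by norm_num)
        nlinarith
      nlinarith
    have hα0 : 0 ≤ α := le_trans (by positivity) hα₁
    have h2 := Nat.ceil_lt_add_one (mul_nonneg hα0 hc0.le)
    have h3 : (c : ℝ) = 3 * b := by exact_mod_cast hcb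
    have h4 : (⌈α * (c : ℝ)⌉₊ : ℝ) < b := by linarith
    exact_mod_cast h4

end

/-- Proposition 2 of the paper.  Points pᵢ = w.getVert (i·c) are placed along a fixed p–q
geodesic w at consecutive distance c = Δ/τ (so Δ = τ·c), each segment being divided in thirds
of length b (c = 3b).  Cᵢ is the cylinder of nodes at distance exactly ⌈αᵢ·c⌉ from the middle
third of the i-th segment.  Any node u in both deleted-graph balls B_{G₋Cᵢ}(pᵢ, aᵢ) and
B_{G₋Cⱼ}(pⱼ, aⱼ) (i + 2 ≤ j) satisfies dist_{G₋Cⱼ}(u, pⱼ) > Δ/(2τ) = c/2. -/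
theorem far_from_center (μ : ℝ) (hμ0 : 0 < μ) (hμ1 : μ < 1) :
    ∃ n₀ : ℕ, ∀ (V : Type) [Fintype V] (G : SimpleGraph V) [DecidableRel G.Adj]
      (δ : ℝ) (d : ℕ) (p q : V) (τ c b i j : ℕ) (w : G.Walk p q)
      (αi αj : ℝ) (Ci Cj : Set V) (ai aj : ℕ),
      G.Connected → n₀ ≤ Fintype.card V → (1 / 2 : ℝ) ≤ δ → IsHyp G δ → 2 < d →
      (∀ v : V, G.degree v ≤ d) →
      0 < τ → 0 < b → c = 3 * b → G.dist p q = τ * c →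
      w.length = G.dist p q →
      4 * τ ≤ G.dist p q → 6 < c →
      ((c : ℝ) / 60 * (2 : ℝ) ^ ((c : ℝ) ^ μ / (28 * δ * logb 2 (2 * d))) >
        (c : ℝ) + 2 * (G.dist p q : ℝ)) →
      i + 2 ≤ j → j + 1 ≤ τ →
      (1 / (28 * (c : ℝ) ^ (1 - μ) * logb 2 (2 * d)) ≤ αi) →
      (αi ≤ 1 / (14 * (c : ℝ) ^ (1 - μ) * logb 2 (2 * d))) →
      (1 / (28 * (c : ℝ) ^ (1 - μ) * logb 2 (2 * d)) ≤ αj) →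
      (αj ≤ 1 / (14 * (c : ℝ) ^ (1 - μ) * logb 2 (2 * d))) →
      (Ci = {u : V | ∃ k : ℕ, i * c + b ≤ k ∧ k ≤ i * c + 2 * b ∧
          G.dist u (w.getVert k) = ⌈αi * (c : ℝ)⌉₊}) →
      (Cj = {u : V | ∃ k : ℕ, j * c + b ≤ k ∧ k ≤ j * c + 2 * b ∧
          G.dist u (w.getVert k) = ⌈αj * (c : ℝ)⌉₊}) →
      ((2 * ai : ℕ∞) ≤ delDist G Ci (w.getVert (i * c)) (w.getVert ((i + 1) * c))) →
      ((2 * aj : ℕ∞) ≤ delDist G Cj (w.getVert (j * c)) (w.getVert ((j + 1) * c))) →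
      ∀ u : V,
        delDist G Ci (w.getVert (i * c)) u ≤ (ai : ℕ∞) →
        delDist G Cj (w.getVert (j * c)) u ≤ (aj : ℕ∞) →
        (c : ℕ∞) < 2 * delDist G Cj u (w.getVert (j * c)) := by
  refine ⟨0, ?_⟩
  intro V _ G _ δ d p q τ c b i j w αi αj Ci Cj ai aj hG _ hδ hyp hd _ _ _ hcb hΔ hw _ hc hexp
    hij hjτ hα₁ hα₂ _ _ hCi _ hai _ u hui _
  obtain ⟨hR, hRb⟩ := two_mul_lt_ceil_and_ceil_lt hμ1 hδ hd hcb hc hexp hα₁ hα₂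
  set R := ⌈αi * (c : ℝ)⌉₊
  by_contra! hcon
  obtain ⟨s, rfl⟩ : ∃ s, j = i + 1 + s := ⟨j - (i + 1), by omega⟩
  have hlen : (i + 1 + s + 1) * c ≤ w.length := by
    rw [hw, hΔ]
    exact Nat.mul_le_mul_right c hjτ
  have hs : c ≤ s * c := Nat.le_mul_of_pos_left c (by omega)
  have e₁ : (i + 1) * c = i * c + c := by ring
  have e₂ : (i + 1 + s) * c = i * c + c + s * c := by ring
  have e₃ : (i + 1 + s + 1) * c = i * c + c + s * c + c := by ring
  obtain ⟨Q₁, hQ₁, hQ₁l⟩ := exists_walk_of_delDist_le hui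
  have hfin : delDist G Cj u (w.getVert ((i + 1 + s) * c)) ≤ (c : ℕ∞) :=
    le_trans (by rw [two_mul]; exact le_self_add) hcon
  obtain ⟨Q₂, hQ₂l⟩ : ∃ r : G.Walk u (w.getVert ((i + 1 + s) * c)), 2 * r.length ≤ c := by
    generalize hm : delDist G Cj u (w.getVert ((i + 1 + s) * c)) = m at hcon hfin
    lift m to ℕ using ne_top_of_le_ne_top (ENat.natCast_ne_top c) hfin
    obtain ⟨r, -, hr⟩ := exists_walk_of_delDist_le hm.le
    have : 2 * m ≤ c := by exact_mod_cast hcon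
    exact ⟨r, by omega⟩
  have hQ₂ : ∀ x ∈ Q₂.support, x ∉ Ci := by
    intro x hx hxC
    rw [hCi] at hxC
    obtain ⟨k, hk₁, hk₂, hk⟩ := hxC
    have h1 := dist_le_length_of_mem_support Q₂ hx
    have h2 := dist_getVert_of_geodesic hG w hw (k := k) (m := (i + 1 + s) * c)
      (by omega) (by omega)
    have h3 := hG.dist_triangle (u := w.getVert k) (v := x) (w := w.getVert ((i + 1 + s) * c))
    rw [SimpleGraph.dist_comm] at hk
    omega
  obtain ⟨Q₃, hQ₃l, hQ₃s⟩ := exists_subwalk w (k := (i + 1) * c) (m := (i + 1 + s) * c)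
    (by omega) (by omega)
  have hQ₃ : ∀ x ∈ Q₃.support, x ∉ Ci := by
    intro x hx hxC
    rw [hCi] at hxC
    obtain ⟨k, hk₁, hk₂, hk⟩ := hxC
    obtain ⟨t, ht₁, ht₂, rfl⟩ := hQ₃s x hx
    have h2 := dist_getVert_of_geodesic hG w hw (k := k) (m := t) (by omega) (by omega)
    rw [SimpleGraph.dist_comm] at hk
    omega
  have hQ : ∀ x ∈ (Q₁.append Q₂).support, x ∉ Ci := by
    intro x hx
    rcases SimpleGraph.Walk.mem_support_append_iff .. |>.1 hx with hx | hx
    exacts [hQ₁ x hx, hQ₂ x hx]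
  have hdetour : 2 * ai ≤ Q₁.length + Q₂.length + Q₃.length := by
    have h1 := hai.trans (delDist_le_length ((Q₁.append Q₂).append Q₃.reverse) (by
      intro x hx
      rcases SimpleGraph.Walk.mem_support_append_iff .. |>.1 hx with hx | hx
      · exact hQ x hx
      · exact hQ₃ x (by simpa using hx)))
    rw [SimpleGraph.Walk.length_append, SimpleGraph.Walk.length_append,
      SimpleGraph.Walk.length_reverse] at h1
    exact_mod_cast h1
  have hd₁ := dist_getVert_of_geodesic hG w hw (k := i * c) (m := (i + 1 + s) * c)
    (by omega) (by omega)
  have hd₂ := dist_getVert_of_geodesic hG w hw (k := i * c) (m := i * c + b)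
    (by omega) (by omega)
  have hd₃ := dist_getVert_of_geodesic hG w hw (k := i * c + b) (m := (i + 1 + s) * c)
    (by omega) (by omega)
  rw [SimpleGraph.dist_comm] at hd₃
  have hclose := hyp.dist_getVert_le (by linarith) (Q₁.append Q₂)
    (by rw [SimpleGraph.Walk.length_append]; omega) (v := w.getVert (i * c + b)) (by omega)
  have hlt := hclose.trans_lt hR
  rw [Nat.cast_lt] at hlt
  have hmem := (Q₁.append Q₂).getVert_mem_support
    (G.dist (w.getVert (i * c)) (w.getVert (i * c + b)))
  obtain ⟨x, hx, hxR⟩ := exists_mem_support_dist_eq hG (R := R)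
    ((Q₁.append Q₂).takeUntil _ hmem) (by omega) hlt.le
  refine hQ x (SimpleGraph.Walk.support_takeUntil_subset_support _ hmem hx) ?_
  rw [hCi]
  exact ⟨i * c + b, by omega, by omega, hxR⟩

end PaperHyp
end

section
/- Let G be a finite simple connected undirected graph, let s and t be distinct nodes of G, and let 0 < r < κ be integers. Then OPT_UUMV(G,s,t,r,κ) = OPT_EHSSC(G,s,t, ⌈κ/r⌉ − 1): the minimum possible number of shared edges over all lists of κ paths from s to t equals the minimum cardinality of a set of edges that intersects the cut-edge set of every s-t cut having at most ⌈κ/r⌉ − 1 cut-edges. -/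
open scoped Classical

namespace PaperHyp

/-- The cut-edge set E_G(S,s,t) of an s–t cut S: edges with exactly one endpoint in S. -/
def cutEdges {V : Type*} (G : SimpleGraph V) (S : Set V) : Set (Sym2 V) :=
  {e | ∃ u v : V, G.Adj u v ∧ u ∈ S ∧ v ∉ S ∧ e = s(u, v)}

/-- The shared edges of a list of κ s–t paths: edges lying on more than r of the paths. -/
noncomputable def sharedEdges {V : Type*} (G : SimpleGraph V) {s t : V} (r : ℕ) {κ : ℕ}
    (P : Fin κ → G.Path s t) : Set (Sym2 V) :=
  {e | r < (Finset.univ.filter fun i : Fin κ => e ∈ (P i).1.edges).card}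

/-- OPT_UUMV(G,s,t,r,κ): the minimum number of shared edges over all lists of κ s–t paths. -/
noncomputable def optUUMV {V : Type*} (G : SimpleGraph V) (s t : V) (r κ : ℕ) : ℕ :=
  sInf {m : ℕ | ∃ P : Fin κ → G.Path s t, (sharedEdges G r P).ncard = m}

/-- Feasibility for EHSSC: a set of edges of G hitting the cut-edge set of every s–t cut
having at most k cut-edges. -/
def EHSSCFeasible {V : Type*} (G : SimpleGraph V) (s t : V) (k : ℕ)
    (E' : Set (Sym2 V)) : Prop :=
  E' ⊆ G.edgeSet ∧
    ∀ S : Set V, s ∈ S → t ∉ S → (cutEdges G S).ncard ≤ k → (E' ∩ cutEdges G S).Nonempty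

/-- OPT_EHSSC(G,s,t,k): minimum cardinality of a feasible hitting set. -/
noncomputable def optEHSSC {V : Type*} (G : SimpleGraph V) (s t : V) (k : ℕ) : ℕ :=
  sInf {m : ℕ | ∃ E' : Set (Sym2 V), EHSSCFeasible G s t k E' ∧ E'.ncard = m}

/-- The cuts with at most `⌈κ / r⌉ - 1` edges are those with `r * c < κ`. -/
lemma le_ceil_div_sub_one_iff {r κ c : ℕ} (hr : 0 < r) (hrκ : r < κ) :
    c ≤ ⌈(κ : ℚ) / r⌉₊ - 1 ↔ r * c < κ := by
  have hr' : (0 : ℚ) < r := by exact_mod_cast hr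
  have hpos : 0 < ⌈(κ : ℚ) / r⌉₊ := by
    rw [Nat.ceil_pos]
    have : (0 : ℚ) < κ := by exact_mod_cast hr.trans hrκ
    positivity
  rw [Nat.le_sub_one_iff_lt hpos, Nat.lt_ceil, lt_div_iff₀ hr', mul_comm]
  exact_mod_cast Iff.rfl

/-- If the relation `R` leaves every `s`-`t` cut, some `s`-`t` path has all its darts in `R`. -/
lemma exists_path_of_forall_cut {V : Type*} {G : SimpleGraph V} {s t : V} {R : V → V → Prop}
    (hR : ∀ u v, R u v → G.Adj u v)
    (hcut : ∀ S : Set V, s ∈ S → t ∉ S → ∃ u ∈ S, ∃ v ∉ S, R u v) :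
    ∃ p : G.Path s t, ∀ d ∈ p.1.darts, R d.fst d.snd := by
  by_cases ht : ∃ p : G.Walk s t, ∀ d ∈ p.darts, R d.fst d.snd
  · obtain ⟨p, hp⟩ := ht
    exact ⟨p.toPath, fun d hd => hp d (p.darts_toPath_subset_darts hd)⟩
  · obtain ⟨u, ⟨p, hp⟩, v, hv, huv⟩ :=
      hcut {x | ∃ p : G.Walk s x, ∀ d ∈ p.darts, R d.fst d.snd} ⟨.nil, by simp⟩ ht
    refine absurd ⟨p.concat (hR u v huv), fun d hd => ?_⟩ hv
    rw [SimpleGraph.Walk.darts_concat, List.concat_eq_append, List.mem_append, List.mem_singleton] at hd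
    rcases hd with hd | rfl
    exacts [hp d hd, huv]

/-- `f` is an integral `s`-`t` flow of value `n`, given by its net amount from `u` to `v`. -/
structure IsFlow {V : Type*} [Fintype V] (s t : V) (n : ℤ) (f : V → V → ℤ) : Prop where
  antisymm : ∀ u v, f u v = -f v u
  sum_eq : ∀ u, ∑ v, f u v = n * ((if u = s then 1 else 0) - if u = t then 1 else 0)

namespace IsFlow

variable {V : Type*} [Fintype V] {s t : V} {m n : ℤ} {f g : V → V → ℤ}

lemma add (hf : IsFlow s t m f) (hg : IsFlow s t n g) : IsFlow s t (m + n) (f + g) where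
  antisymm u v := by
    simp only [Pi.add_apply]; linarith [hf.antisymm u v, hg.antisymm u v]
  sum_eq u := by
    simp only [Pi.add_apply, Finset.sum_add_distrib, hf.sum_eq, hg.sum_eq, add_mul]

lemma sub (hf : IsFlow s t m f) (hg : IsFlow s t n g) : IsFlow s t (m - n) (f - g) where
  antisymm u v := by
    simp only [Pi.sub_apply]; linarith [hf.antisymm u v, hg.antisymm u v]
  sum_eq u := by
    simp only [Pi.sub_apply, Finset.sum_sub_distrib, hf.sum_eq, hg.sum_eq, sub_mul]

/-- The net amount of flow through any `s`-`t` cut is the value of the flow. -/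
lemma sum_cut (hf : IsFlow s t n f) {S : Finset V} (hs : s ∈ S) (ht : t ∉ S) :
    ∑ u ∈ S, ∑ v ∈ Sᶜ, f u v = n := by
  have hin : ∑ u ∈ S, ∑ v ∈ S, f u v = 0 := by
    have h : ∑ u ∈ S, ∑ v ∈ S, f u v = -∑ u ∈ S, ∑ v ∈ S, f u v := by
      conv_lhs => rw [Finset.sum_comm]
      simp only [← Finset.sum_neg_distrib]
      exact Finset.sum_congr rfl fun u _ => Finset.sum_congr rfl fun v _ => hf.antisymm v u
    linarith
  have hall : ∑ u ∈ S, ∑ v, f u v = n := by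
    simp only [hf.sum_eq, ← Finset.mul_sum, Finset.sum_sub_distrib, Finset.sum_ite_eq',
      if_pos hs, if_neg ht]
    ring
  simp only [← Finset.sum_add_sum_compl S, Finset.sum_add_distrib] at hall
  linarith

end IsFlow

/-- The unit flow along a walk. -/
noncomputable def walkFlow {V : Type*} {G : SimpleGraph V} :
    {s t : V} → G.Walk s t → V → V → ℤ
  | _, _, .nil => 0
  | _, _, .cons (u := a) (v := b) _ p => fun u v =>
      ((if u = a ∧ v = b then 1 else 0) - if u = b ∧ v = a then 1 else 0) + walkFlow p u v

lemma isFlow_walkFlow {V : Type*} [Fintype V] {G : SimpleGraph V} {s t : V} (p : G.Walk s t) :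
    IsFlow s t 1 (walkFlow p) := by
  induction p with
  | nil => exact ⟨by simp [walkFlow], by simp [walkFlow]⟩
  | @cons a b c h p ih =>
    refine ⟨fun u v => ?_, fun u => ?_⟩
    · simp only [walkFlow, ih.antisymm u v, and_comm]
      ring
    · simp only [walkFlow, Finset.sum_add_distrib, Finset.sum_sub_distrib, ih.sum_eq, ite_and]
      by_cases ha : u = a <;> by_cases hb : u = b <;> simp [ha, hb]

lemma walkFlow_eq_zero {V : Type*} {G : SimpleGraph V} {s t : V} (p : G.Walk s t) {u v : V}
    (h : s(u, v) ∉ p.edges) : walkFlow p u v = 0 := by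
  induction p with
  | nil => rfl
  | cons hab p ih =>
    simp only [SimpleGraph.Walk.edges_cons, List.mem_cons, Sym2.eq_iff, not_or] at h
    simp [walkFlow, ih h.2, h.1.1, h.1.2]

/-- A trail carries one unit of flow along each edge, in the direction of its dart there. -/
lemma walkFlow_of_mem_edges {V : Type*} {G : SimpleGraph V} {s t : V} {p : G.Walk s t}
    (hp : p.IsTrail) {u v : V} (h : s(u, v) ∈ p.edges) :
    (walkFlow p u v = 1 ∧ ∃ d ∈ p.darts, d.fst = u ∧ d.snd = v) ∨
      (walkFlow p u v = -1 ∧ ∃ d ∈ p.darts, d.fst = v ∧ d.snd = u) := by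
  induction p with
  | nil => simp at h
  | @cons a b c hab p ih =>
    rw [SimpleGraph.Walk.isTrail_cons] at hp
    by_cases he : s(u, v) = s(a, b)
    · have h0 : walkFlow p u v = 0 := walkFlow_eq_zero p (he ▸ hp.2)
      rcases Sym2.eq_iff.1 he with ⟨rfl, rfl⟩ | ⟨rfl, rfl⟩
      · exact .inl ⟨by simp [walkFlow, h0, hab.ne], ⟨(u, v), hab⟩, by simp⟩
      · exact .inr ⟨by simp [walkFlow, h0, hab.ne], ⟨(v, u), hab⟩, by simp⟩
    · have h' : s(u, v) ∈ p.edges := by simpa [he] using h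
      have hw : walkFlow (.cons hab p) u v = walkFlow p u v := by
        rw [Sym2.eq_iff, not_or] at he
        simp [walkFlow, he.1, he.2]
      rw [hw]
      refine (ih hp.1 h').imp ?_ ?_ <;>
      · rintro ⟨h1, d, hd, h2⟩
        exact ⟨h1, d, List.mem_cons_of_mem _ hd, h2⟩

/-- Max-flow min-cut for undirected integral capacities `c`. -/
lemma exists_isFlow_le {V : Type*} [Fintype V] {G : SimpleGraph V} {s t : V} {c : V → V → ℤ}
    (hc0 : ∀ u v, 0 ≤ c u v) (hcG : ∀ u v, ¬ G.Adj u v → c u v = 0) (n : ℕ)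
    (hcut : ∀ S : Finset V, s ∈ S → t ∉ S → n ≤ ∑ u ∈ S, ∑ v ∈ Sᶜ, c u v) :
    ∃ f, IsFlow s t n f ∧ ∀ u v, f u v ≤ c u v := by
  induction n with
  | zero => exact ⟨0, ⟨by simp, by simp⟩, hc0⟩
  | succ n ih =>
    obtain ⟨f, hf, hfc⟩ := ih fun S hs ht => le_trans (by simp) (hcut S hs ht)
    have hR : ∀ u v, f u v < c u v → G.Adj u v := by
      intro u v h
      by_contra hn
      have h1 := hcG u v hn
      have h2 := hcG v u fun h => hn h.symm
      linarith [hfc v u, hf.antisymm u v]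
    obtain ⟨p, hp⟩ := exists_path_of_forall_cut (s := s) (t := t) hR (by
      intro S hs ht
      by_contra! hS
      have h1 := hcut S.toFinset (by simpa) (by simpa)
      have h2 := hf.sum_cut (S := S.toFinset) (by simpa) (by simpa)
      have h3 : ∑ u ∈ S.toFinset, ∑ v ∈ S.toFinsetᶜ, c u v ≤
          ∑ u ∈ S.toFinset, ∑ v ∈ S.toFinsetᶜ, f u v :=
        Finset.sum_le_sum fun u hu => Finset.sum_le_sum fun v hv =>
          hS u (by simpa using hu) v (by simpa using hv)
      push_cast at h1
      linarith)
    refine ⟨f + walkFlow p.1, by exact_mod_cast hf.add (isFlow_walkFlow p.1), fun u v => ?_⟩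
    simp only [Pi.add_apply]
    by_cases he : s(u, v) ∈ p.1.edges
    · rcases walkFlow_of_mem_edges p.2.isTrail he with ⟨h, d, hd, rfl, rfl⟩ | ⟨h, -⟩
      · have := hp d hd
        omega
      · have := hfc u v
        omega
    · rw [walkFlow_eq_zero _ he, add_zero]
      exact hfc u v

/-- A flow of value `n` decomposes into `n` paths, up to cancelling cycles. -/
lemma IsFlow.exists_paths {V : Type*} [Fintype V] {G : SimpleGraph V} {s t : V} (n : ℕ)
    {f : V → V → ℤ} (hf : IsFlow s t n f) (hG : ∀ u v, 0 < f u v → G.Adj u v) :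
    ∃ P : Fin n → G.Path s t, ∀ u v,
      ((Finset.univ.filter fun i => s(u, v) ∈ (P i).1.edges).card : ℤ) ≤ |f u v| := by
  induction n generalizing f with
  | zero => exact ⟨Fin.elim0, by simp⟩
  | succ n ih =>
    obtain ⟨p, hp⟩ := exists_path_of_forall_cut (s := s) (t := t) hG (by
      intro S hs ht
      by_contra! hS
      have h2 := hf.sum_cut (S := S.toFinset) (by simpa) (by simpa)
      have h3 : ∑ u ∈ S.toFinset, ∑ v ∈ S.toFinsetᶜ, f u v ≤ 0 :=
        Finset.sum_nonpos fun u hu => Finset.sum_nonpos fun v hv =>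
          hS u (by simpa using hu) v (by simpa using hv)
      push_cast at h2
      linarith)
    have habs : ∀ u v, |f u v - walkFlow p.1 u v| +
        (if s(u, v) ∈ p.1.edges then 1 else 0) = |f u v| ∧
        (0 < f u v - walkFlow p.1 u v → 0 < f u v) := by
      intro u v
      split_ifs with he
      · rcases walkFlow_of_mem_edges p.2.isTrail he with ⟨h, d, hd, rfl, rfl⟩ | ⟨h, d, hd, rfl, rfl⟩
        · have := hp d hd
          grind
        · have := hp d hd
          have := hf.antisymm d.fst d.snd
          grind
      · simp [walkFlow_eq_zero _ he]
    have hf' : IsFlow s t n (f - walkFlow p.1) := by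
      simpa using hf.sub (isFlow_walkFlow p.1)
    obtain ⟨P, hP⟩ := ih hf' fun u v h => hG u v ((habs u v).2 h)
    refine ⟨Fin.cons p P, fun u v => ?_⟩
    rw [← (habs u v).1, Finset.card_filter, Fin.sum_univ_succ]
    have := hP u v
    rw [Finset.card_filter] at this
    simp only [Fin.cons_zero, Fin.cons_succ]
    push_cast at this ⊢
    simp only [Pi.sub_apply] at this
    linarith

lemma exists_mem_edges_cutEdges {V : Type*} {G : SimpleGraph V} {s t : V} (p : G.Walk s t)
    {S : Set V} (hs : s ∈ S) (ht : t ∉ S) : ∃ e ∈ p.edges, e ∈ cutEdges G S := by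
  obtain ⟨d, hd, h1, h2⟩ := p.exists_boundary_dart S hs ht
  exact ⟨d.edge, List.mem_map_of_mem hd, d.fst, d.snd, d.adj, h1, h2, rfl⟩

lemma sharedEdges_subset_edgeSet {V : Type*} {G : SimpleGraph V} {s t : V} {r κ : ℕ}
    (P : Fin κ → G.Path s t) : sharedEdges G r P ⊆ G.edgeSet := by
  intro e he
  obtain ⟨i, hi⟩ := Finset.card_pos.1 ((Nat.zero_le r).trans_lt he)
  exact (P i).1.edges_subset_edgeSet (Finset.mem_filter.1 hi).2

lemma ehsscFeasible_sharedEdges {V : Type*} [Fintype V] {G : SimpleGraph V} {s t : V} {r κ : ℕ}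
    (hr : 0 < r) (hrκ : r < κ) (P : Fin κ → G.Path s t) :
    EHSSCFeasible G s t (⌈(κ : ℚ) / r⌉₊ - 1) (sharedEdges G r P) := by
  refine ⟨sharedEdges_subset_edgeSet P, fun S hs ht hS => ?_⟩
  rw [le_ceil_div_sub_one_iff hr hrκ] at hS
  by_contra hne
  have hle : ∀ e ∈ (cutEdges G S).toFinset,
      (Finset.univ.filter fun i : Fin κ => e ∈ (P i).1.edges).card ≤ r := by
    intro e he
    by_contra! h
    exact hne ⟨e, h, by simpa using he⟩
  have hcover : (Finset.univ : Finset (Fin κ)) ⊆ (cutEdges G S).toFinset.biUnion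
      fun e => Finset.univ.filter fun i : Fin κ => e ∈ (P i).1.edges := by
    intro i _
    obtain ⟨e, he, heS⟩ := exists_mem_edges_cutEdges (P i).1 hs ht
    simp only [Finset.mem_biUnion, Finset.mem_filter, Finset.mem_univ, true_and, Set.mem_toFinset]
    exact ⟨e, heS, he⟩
  have h := (Finset.card_le_card hcover).trans (Finset.card_biUnion_le_card_mul _ _ r hle)
  rw [Finset.card_univ, Fintype.card_fin, ← Set.ncard_eq_toFinset_card', mul_comm] at h
  omega

lemma exists_sharedEdges_subset {V : Type*} [Fintype V] {G : SimpleGraph V} {s t : V} {r κ : ℕ}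
    (hr : 0 < r) (hrκ : r < κ) {E' : Set (Sym2 V)}
    (hE : EHSSCFeasible G s t (⌈(κ : ℚ) / r⌉₊ - 1) E') :
    ∃ P : Fin κ → G.Path s t, sharedEdges G r P ⊆ E' := by
  let c : V → V → ℤ := fun u v => if G.Adj u v then if s(u, v) ∈ E' then κ else r else 0
  have hc0 : ∀ u v, 0 ≤ c u v := fun u v => by
    simp only [c]
    split_ifs <;> simp
  obtain ⟨f, hf, hfc⟩ := exists_isFlow_le (G := G) (s := s) (t := t) hc0
    (fun u v h => if_neg h) κ (by
      intro S hs ht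
      rw [← Finset.sum_product']
      by_cases hex : (E' ∩ cutEdges G S).Nonempty
      · obtain ⟨e, heE, u, v, huv, hu, hv, rfl⟩ := hex
        have : c u v = κ := by simp [c, huv, heE]
        rw [← this]
        exact Finset.single_le_sum (f := fun x : V × V => c x.1 x.2) (fun x _ => hc0 x.1 x.2)
          (a := (u, v)) (by simpa using ⟨hu, hv⟩)
      · have hlt : κ ≤ r * (cutEdges G S).ncard := by
          by_contra! h
          exact hex (hE.2 S hs ht ((le_ceil_div_sub_one_iff hr hrκ).2 h))
        have himg : cutEdges G S ⊆
            ((S ×ˢ Sᶜ).filter fun x => G.Adj x.1 x.2).image fun x => s(x.1, x.2) := by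
          rintro e ⟨u, v, huv, hu, hv, rfl⟩
          simp only [Finset.coe_image, Set.mem_image]
          exact ⟨(u, v), by simpa using ⟨⟨hu, hv⟩, huv⟩, rfl⟩
        have hcard : (cutEdges G S).ncard ≤
            ((S ×ˢ Sᶜ).filter fun x => G.Adj x.1 x.2).card := by
          have := Set.ncard_le_ncard himg (Finset.finite_toSet _)
          rw [Set.ncard_coe_finset] at this
          exact this.trans Finset.card_image_le
        have hsum : ∑ x ∈ S ×ˢ Sᶜ, c x.1 x.2 =
            (r * ((S ×ˢ Sᶜ).filter fun x => G.Adj x.1 x.2).card : ℕ) := by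
          rw [Finset.card_filter, Finset.mul_sum]
          push_cast
          refine Finset.sum_congr rfl fun x hx => ?_
          rw [Finset.mem_product, Finset.mem_compl] at hx
          by_cases ha : G.Adj x.1 x.2
          · have : s(x.1, x.2) ∉ E' := fun h => hex ⟨_, h, x.1, x.2, ha, hx.1, hx.2, rfl⟩
            simp [c, ha, this]
          · simp [c, ha]
        rw [hsum]
        exact_mod_cast hlt.trans (Nat.mul_le_mul_left r hcard))
  obtain ⟨P, hP⟩ := hf.exists_paths κ (G := G) (by
    intro u v h
    by_contra hn
    have := hfc u v
    simp only [c, if_neg hn] at this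
    omega)
  refine ⟨P, fun e he => ?_⟩
  induction e with | _ u v
  have huv : G.Adj u v := sharedEdges_subset_edgeSet P he
  by_contra hn
  have h1 := hfc u v
  have h2 := hfc v u
  simp only [c, huv, huv.symm, if_true, Sym2.eq_swap (a := v), hn, if_false] at h1 h2
  have h3 : |f u v| ≤ r := abs_le.2 ⟨by linarith [hf.antisymm u v], h1⟩
  have h4 : (r : ℤ) < (Finset.univ.filter fun i => s(u, v) ∈ (P i).1.edges).card := by
    exact_mod_cast he
  linarith [hP u v]

/-- Lemma 2 of the paper: OPT_UUMV(G,s,t,r,κ) = OPT_EHSSC(G,s,t,⌈κ/r⌉ − 1). -/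
theorem uumv_eq_ehssc (V : Type) [Fintype V] (G : SimpleGraph V) (s t : V) (r κ : ℕ)
    (hconn : G.Connected) (hst : s ≠ t) (hr : 0 < r) (hrκ : r < κ) :
    optUUMV G s t r κ = optEHSSC G s t (⌈(κ : ℚ) / r⌉₊ - 1) := by
  apply le_antisymm
  · refine le_csInf ?_ ?_
    · obtain ⟨p⟩ := hconn.preconnected s t
      exact ⟨_, _, ehsscFeasible_sharedEdges hr hrκ fun _ => p.toPath, rfl⟩
    · rintro _ ⟨E', hE, rfl⟩
      obtain ⟨P, hP⟩ := exists_sharedEdges_subset hr hrκ hE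
      exact le_trans (Nat.sInf_le ⟨P, rfl⟩) (Set.ncard_le_ncard hP (Set.toFinite _))
  · refine le_csInf ?_ ?_
    · obtain ⟨p⟩ := hconn.preconnected s t
      exact ⟨_, fun _ => p.toPath, rfl⟩
    · rintro _ ⟨P, rfl⟩
      exact Nat.sInf_le ⟨_, ehsscFeasible_sharedEdges hr hrκ P, rfl⟩

end PaperHyp
end

section
/- Let G be a finite simple connected undirected graph, let s and t be distinct nodes, let 0 < r < κ be integers, and let P₁, …, P_κ be any list of κ (not necessarily distinct) paths from s to t in G. Then for every s-t cut S with |E_G(S,s,t)| ≤ ⌈κ/r⌉ − 1, at least one edge of E_G(S,s,t) lies on more than r of the κ paths; equivalently, the set of shared edges of any list of κ s-t paths intersects the cut-edge set of every s-t cut having at most ⌈κ/r⌉ − 1 cut-edges. -/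
open scoped Classical

namespace PaperHyp

/-- Every walk leaving `S` uses a cut-edge of `S`. -/
lemma exists_mem_cutEdges_of_walk {V : Type*} {G : SimpleGraph V} {S : Set V} {s t : V}
    (p : G.Walk s t) (hs : s ∈ S) (ht : t ∉ S) : ∃ e ∈ cutEdges G S, e ∈ p.edges := by
  obtain ⟨d, hd, hfst, hsnd⟩ := p.exists_boundary_dart S hs ht
  exact ⟨d.edge, ⟨d.fst, d.snd, d.adj, hfst, hsnd, rfl⟩, List.mem_map_of_mem hd⟩

/-- For any list of κ s–t paths and any s–t cut with at most ⌈κ/r⌉ − 1 cut-edges,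
some cut-edge lies on more than r of the κ paths. -/
theorem shared_edges_hit_small_cuts (V : Type) [Fintype V] (G : SimpleGraph V)
    (s t : V) (r κ : ℕ)
    (hconn : G.Connected) (hst : s ≠ t) (hr : 0 < r) (hrκ : r < κ)
    (P : Fin κ → G.Path s t) :
    ∀ S : Set V, s ∈ S → t ∉ S → (cutEdges G S).ncard ≤ ⌈(κ : ℚ) / r⌉₊ - 1 →
      ∃ e ∈ cutEdges G S,
        r < (Finset.univ.filter fun i : Fin κ => e ∈ (P i).1.edges).card := by
  intro S hs ht hcard
  choose f hf hfP using fun i => exists_mem_cutEdges_of_walk (P i).1 hs ht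
  have hfin : (cutEdges G S).Finite := Set.toFinite _
  have hceil : 0 < ⌈(κ : ℚ) / r⌉₊ := by
    have : 0 < κ := by omega
    exact Nat.ceil_pos.2 (by positivity)
  have hlt : (cutEdges G S).ncard * r < κ := by
    have h : (((cutEdges G S).ncard : ℕ) : ℚ) < κ / r := Nat.lt_ceil.1 (by omega)
    rw [lt_div_iff₀ (by exact_mod_cast hr)] at h
    exact_mod_cast h
  obtain ⟨e, he, hre⟩ := Finset.exists_lt_card_fiber_of_mul_lt_card_of_maps_to
    (s := Finset.univ) (t := hfin.toFinset) (f := f) (n := r)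
    (fun i _ => hfin.mem_toFinset.2 (hf i))
    (by rwa [← Set.ncard_eq_toFinset_card _ hfin, Finset.card_univ, Fintype.card_fin])
  refine ⟨e, hfin.mem_toFinset.1 he, hre.trans_le (Finset.card_le_card fun i hi => ?_)⟩
  simp only [Finset.mem_filter, Finset.mem_univ, true_and] at hi ⊢
  exact hi ▸ hfP i

end PaperHyp
end
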